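/- For every L ≥ 2 there exist positive constants c(L) and C(L), depending only on L, such that for every doubling weight function w on [-1,1] with doubling constant L and every integer n ≥ 1: (i) every Chebyshev-type quadrature of degree n for w has at least c(L)·R_w(n) nodes, and (ii) for every integer N ≥ C(L)·R_w(n) there exists a Chebyshev-type quadrature of degree n for w with exactly N nodes. -/

import Mathlib

open MeasureTheory Real Set

noncomputable section

/-- A weight function on `[-1,1]`: nonnegative, zero outside `[-1,1]`, integrable,
with positive integral. -/
def IsWeight (w : ℝ → ℝ) : Prop :=
  Measurable w ∧ (∀ t, 0 ≤ w t) ∧ (∀ t, t ∉ Icc (-1:ℝ) 1 → w t = 0) ∧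
  IntervalIntegrable w volume (-1) 1 ∧ 0 < ∫ t in (-1:ℝ)..1, w t

/-- `w` is doubling with doubling constant `L`. -/
def IsDoubling (w : ℝ → ℝ) (L : ℝ) : Prop :=
  ∀ δ : ℝ, 0 < δ → ∀ a ∈ Icc (-1:ℝ) 1,
    (∫ t in (a - 2*δ)..(a + 2*δ), w t) ≤ L * ∫ t in (a - δ)..(a + δ), w t

/-- A Chebyshev-type quadrature of degree `n` for `w` with `N` nodes. -/
def IsChebQuad (w : ℝ → ℝ) (n N : ℕ) (t : Fin N → ℝ) : Prop :=
  Monotone t ∧ (∀ i, t i ∈ Icc (-1:ℝ) 1) ∧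
  ∀ p : Polynomial ℝ, p.natDegree ≤ n →
    (∫ x in (-1:ℝ)..1, p.eval x * w x) =
      ((∫ x in (-1:ℝ)..1, w x) / N) * ∑ i, p.eval (t i)

/-- `Δ_n(x) = (1/n)(√(1-x²) + 1/n)`. -/
def Δn (n : ℕ) (x : ℝ) : ℝ := (1 / n) * (Real.sqrt (1 - x ^ 2) + 1 / n)

/-- `R_w(n)`. -/
def Rw (w : ℝ → ℝ) (n : ℕ) : ℝ :=
  (∫ t in (-1:ℝ)..1, w t) /
    sInf ((fun x => ∫ t in (x - Δn n x)..(x + Δn n x), w t) '' Icc (-1:ℝ) 1)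

section Brouwer

variable {E : Type*} [NormedAddCommGroup E] [InnerProductSpace ℝ E] [FiniteDimensional ℝ E]

/-- The determinant of an affine pencil of endomorphisms is a polynomial in the parameter. -/
lemma exists_polynomial_eval_eq_det_one_add_smul (A : E →L[ℝ] E) :
    ∃ p : Polynomial ℝ, p.natDegree ≤ Module.finrank ℝ E ∧
      ∀ t : ℝ, p.eval t = (1 + t • A : E →L[ℝ] E).det := by
  classical
  let b := Module.finBasis ℝ E
  let M := LinearMap.toMatrix b b (A : E →ₗ[ℝ] E)
  refine ⟨((Polynomial.X : Polynomial ℝ) • M.map Polynomial.C +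
    (1 : Matrix (Fin (Module.finrank ℝ E)) (Fin (Module.finrank ℝ E)) ℝ).map Polynomial.C).det,
    ?_, fun t => ?_⟩
  · simpa using Polynomial.natDegree_det_X_add_C_le M 1
  · rw [← Polynomial.coe_evalRingHom, RingHom.map_det, ContinuousLinearMap.det,
      ← LinearMap.det_toMatrix b]
    congr 1
    have : (((1 + t • A : E →L[ℝ] E)) : E →ₗ[ℝ] E) = LinearMap.id + t • (A : E →ₗ[ℝ] E) := rfl
    have h2 : LinearMap.toMatrix b b ((1 + t • A : E →L[ℝ] E) : E →ₗ[ℝ] E) = 1 + t • M := by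
      rw [this, LinearEquiv.map_add, LinearEquiv.map_smul, LinearMap.toMatrix_id]
    rw [h2]
    ext i j
    simp [Matrix.one_apply, apply_ite, add_comm]
    ring

/-- Values at `1` of polynomials of bounded degree are a fixed linear combination of values at
given distinct points. -/
lemma exists_extrapolation_coeff {d : ℕ} (v : Fin (d + 1) → ℝ) (hv : Function.Injective v) :
    ∃ c : Fin (d + 1) → ℝ, ∀ p : Polynomial ℝ, p.natDegree ≤ d →
      p.eval 1 = ∑ i, c i * p.eval (v i) := by
  refine ⟨fun i => (Lagrange.basis Finset.univ v i).eval 1, fun p hp => ?_⟩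
  have := Lagrange.eq_interpolate (s := Finset.univ) (f := p) (v := v) hv.injOn (by
    refine lt_of_le_of_lt Polynomial.degree_le_natDegree ?_
    simp only [Finset.card_univ, Fintype.card_fin]
    exact_mod_cast Nat.lt_succ_of_le hp)
  conv_lhs => rw [this]
  rw [Lagrange.interpolate_apply, Polynomial.eval_finsetSum]
  refine Finset.sum_congr rfl fun i _ => ?_
  simp [mul_comm]

/-- A perturbation of the identity by a small Lipschitz map vanishing outside a ball preserves
the ball, and it is injective. -/
lemma image_ball_eq_of_lipschitz_perturbation {R : ℝ} {K : NNReal} (hK : K < 1) {g : E → E}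
    (hg : LipschitzWith K g) (h0 : ∀ x, R ≤ ‖x‖ → g x = 0) :
    Function.Injective (fun x => x + g x) ∧
      (fun x => x + g x) '' Metric.ball 0 R = Metric.ball 0 R := by
  have happ : ApproximatesLinearOn (fun x => x + g x)
      ((ContinuousLinearEquiv.refl ℝ E : E ≃L[ℝ] E) : E →L[ℝ] E) univ K := by
    intro x _ y _
    have h := hg.dist_le_mul x y
    rw [dist_eq_norm, dist_eq_norm] at h
    have h2 : x + g x - (y + g y) - (x - y) = g x - g y := by abel
    change ‖x + g x - (y + g y) - (x - y)‖ ≤ _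
    rwa [h2]
  have hc : Subsingleton E ∨ K < ‖((ContinuousLinearEquiv.refl ℝ E).symm : E →L[ℝ] E)‖₊⁻¹ := by
    rcases subsingleton_or_nontrivial E with h | h
    · exact Or.inl h
    · right
      have : ‖((ContinuousLinearEquiv.refl ℝ E).symm : E →L[ℝ] E)‖₊ = 1 := by
        ext
        exact ContinuousLinearMap.norm_id
      rw [this]; simpa using hK
  have hbij := (happ.toHomeomorph _ hc).bijective
  have hcoe : ⇑(happ.toHomeomorph _ hc) = fun x => x + g x := rfl
  rw [hcoe] at hbij
  refine ⟨hbij.1, ?_⟩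
  have hcompl : (fun x => x + g x) '' (Metric.ball 0 R)ᶜ = (Metric.ball 0 R)ᶜ := by
    have : EqOn (fun x => x + g x) id (Metric.ball (0 : E) R)ᶜ := by
      intro x hx
      have : R ≤ ‖x‖ := by simpa using hx
      simp [h0 x this]
    rw [this.image_eq, image_id]
  rw [image_compl_eq hbij] at hcompl
  exact compl_injective hcompl

lemma not_exists_contDiff_retraction_sphere {R : ℝ} (hR : 0 < R) (r : E → E)
    (hr : ContDiff ℝ 1 r) (hn : ∀ x, ‖r x‖ = R) (hid : ∀ x, ‖x‖ = R → r x = x) : False := by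
  let _ : MeasurableSpace E := borel E
  have _ : BorelSpace E := ⟨rfl⟩
  set B : Set E := Metric.ball 0 R
  obtain ⟨K, hK⟩ := ((hr.sub contDiff_id).locallyLipschitz.locallyLipschitzOn
    (s := Metric.closedBall (0 : E) R)).exists_lipschitzOnWith_of_compact
      (isCompact_closedBall 0 R)
  let g : E → E := fun x => if ‖x‖ ≤ R then r x - x else 0
  have hgout : ∀ x, R ≤ ‖x‖ → g x = 0 := by
    intro x hx
    by_cases h : ‖x‖ ≤ R
    · simp [g, h, hid x (le_antisymm h hx)]
    · simp [g, h]
  have hmix : ∀ x y : E, ‖x‖ ≤ R → R < ‖y‖ → ‖g x‖ ≤ 2 * K * ‖x - y‖ := by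
    intro x y hx hy
    have hy0 : 0 < ‖y‖ := hR.trans hy
    set z : E := (R / ‖y‖) • y with hz
    have hzn : ‖z‖ = R := by
      rw [hz, norm_smul, Real.norm_of_nonneg (by positivity)]; field_simp
    have h1 := hK.dist_le_mul x (by simpa using hx) z (by simp [hzn])
    have hzz : r z - z = 0 := by rw [hid z hzn, sub_self]
    have h2 : ‖y - z‖ = ‖y‖ - R := by
      have : y - z = (1 - R / ‖y‖) • y := by rw [hz, sub_smul, one_smul]
      rw [this, norm_smul, Real.norm_of_nonneg]
      · field_simp
      · rw [sub_nonneg, div_le_one hy0]; exact hy.le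
    have h3 : ‖y‖ ≤ ‖x‖ + ‖x - y‖ := by
      have := norm_sub_le x (x - y); simpa using this
    have h4 : ‖x - z‖ ≤ ‖x - y‖ + ‖y - z‖ := by
      have := norm_add_le (x - y) (y - z); simpa using this
    simp only [dist_eq_norm, id] at h1
    change ‖(r x - x) - (r z - z)‖ ≤ _ at h1
    rw [hzz, sub_zero] at h1
    simp only [g, hx, if_true]
    have : (K : ℝ) * ‖x - z‖ ≤ K * (2 * ‖x - y‖) := by gcongr; linarith
    linarith
  have hgl : LipschitzWith (2 * K) g := by
    refine LipschitzWith.of_dist_le_mul fun x y => ?_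
    simp only [dist_eq_norm, NNReal.coe_mul, NNReal.coe_ofNat]
    rcases le_or_gt ‖x‖ R with hx | hx <;> rcases le_or_gt ‖y‖ R with hy | hy
    · have h1 := hK.dist_le_mul x (by simpa using hx) y (by simpa using hy)
      simp only [dist_eq_norm] at h1
      change ‖(r x - x) - (r y - y)‖ ≤ _ at h1
      simp only [g, hx, hy, if_true]
      refine h1.trans ?_
      have : 0 ≤ (K : ℝ) * ‖x - y‖ := by positivity
      linarith
    · rw [hgout y hy.le, sub_zero]; exact hmix x y hx hy
    · rw [hgout x hx.le, zero_sub, norm_neg, norm_sub_rev]; exact hmix y x hy hx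
    · rw [hgout y hy.le, hgout x hx.le]; simp; positivity
  let D : E → E →L[ℝ] E := fun x => fderiv ℝ r x - 1
  have hDc : Continuous D := (hr.continuous_fderiv one_ne_zero).sub continuous_const
  have hgd : ∀ x ∈ B, ∀ t : ℝ, HasFDerivWithinAt (fun x => x + (t • g) x) (1 + t • D x) B x := by
    intro x hx t
    have h1 : HasFDerivAt (fun x => x + t • (r x - x)) (1 + t • D x) x :=
      (hasFDerivAt_id x).add
        ((((hr.differentiable one_ne_zero) x).hasFDerivAt.sub (hasFDerivAt_id x)).const_smul t)
    refine (h1.hasFDerivWithinAt (s := B)).congr (fun y hy => ?_) ?_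
    · have : ‖y‖ ≤ R := by have := hy; simp [B] at this; exact this.le
      simp [g, this]
    · have : ‖x‖ ≤ R := by have := hx; simp [B] at this; exact this.le
      simp [g, this]
  -- for small parameters the determinant is positive and the map preserves volume
  obtain ⟨M, hM⟩ := (isCompact_closedBall (0 : E) R).exists_bound_of_continuousOn
    (f := D) hDc.continuousOn
  have hpos : ∀ᶠ A : E →L[ℝ] E in nhds 0, 0 < (1 + A).det := by
    have hc : Continuous fun A : E →L[ℝ] E => (1 + A).det :=
      ContinuousLinearMap.continuous_det.comp (continuous_const.add continuous_id)
    refine hc.continuousAt.eventually (lt_mem_nhds ?_)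
    have : ((1 : E →L[ℝ] E) + 0).det = 1 := by
      rw [add_zero, ContinuousLinearMap.det]; exact LinearMap.det_id
    simp only [this]; exact one_pos
  obtain ⟨ε, hε, hball⟩ := Metric.eventually_nhds_iff.1 hpos
  obtain ⟨δ, hδ, hδ1, hδ2⟩ : ∃ δ : ℝ, 0 < δ ∧ δ * (2 * K) < 1 ∧ δ * |M| < ε := by
    refine ⟨min (1 / (2 * K + 1)) (ε / (|M| + 1)), by positivity, ?_, ?_⟩
    · calc _ ≤ (1 / (2 * K + 1)) * (2 * K : ℝ) := by gcongr; exact min_le_left _ _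
        _ < 1 := by rw [div_mul_eq_mul_div, div_lt_one (by positivity)]; linarith
    · calc _ ≤ (ε / (|M| + 1)) * |M| := by gcongr; exact min_le_right _ _
        _ < ε := by
          rw [div_mul_eq_mul_div, div_lt_iff₀ (by positivity)]; nlinarith
  have hvol : ∀ t : ℝ, 0 < t → t ≤ δ → ∫ x in B, (1 + t • D x).det = volume.real B := by
    intro t ht htδ
    have hlip : LipschitzWith (Real.toNNReal t * (2 * K)) (t • g) := by
      have := hgl
      refine LipschitzWith.of_dist_le_mul fun x y => ?_
      have h := hgl.dist_le_mul x y
      simp only [dist_eq_norm, Pi.smul_apply, ← smul_sub, norm_smul, Real.norm_of_nonneg ht.le,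
        NNReal.coe_mul, Real.coe_toNNReal t ht.le, NNReal.coe_ofNat] at h ⊢
      calc _ ≤ t * (2 * K * ‖x - y‖) := by gcongr
        _ = _ := by ring
    have hlt : Real.toNNReal t * (2 * K) < 1 := by
      rw [← NNReal.coe_lt_coe]
      push_cast
      rw [Real.coe_toNNReal t ht.le]
      refine lt_of_le_of_lt ?_ hδ1
      gcongr
    obtain ⟨hinj, him⟩ := image_ball_eq_of_lipschitz_perturbation (R := R) hlt hlip (by
      intro x hx; simp [hgout x hx])
    have := integral_image_eq_integral_abs_det_fderiv_smul volume
      (Metric.isOpen_ball.measurableSet : MeasurableSet B) (fun x hx => hgd x hx t)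
      hinj.injOn (fun _ => (1 : ℝ))
    rw [him] at this
    simp only [smul_eq_mul, mul_one, setIntegral_const] at this
    rw [show (volume.real B) = volume.real (Metric.ball (0 : E) R) from rfl, this]
    refine setIntegral_congr_fun Metric.isOpen_ball.measurableSet fun x hx => ?_
    refine (abs_of_pos (hball ?_)).symm
    rw [dist_zero_right, norm_smul, Real.norm_of_nonneg ht.le]
    refine lt_of_le_of_lt ?_ hδ2
    have := hM x (Metric.ball_subset_closedBall hx)
    gcongr
    exact this.trans (le_abs_self M)
  -- extrapolation to the parameter `1`, where the determinant vanishes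
  let d := Module.finrank ℝ E
  let v : Fin (d + 1) → ℝ := fun i => δ / ((i : ℕ) + 1)
  have hvpos : ∀ i, 0 < v i := fun i => by positivity
  have hvle : ∀ i, v i ≤ δ := fun i => div_le_self hδ.le (by simp)
  have hvinj : Function.Injective v := by
    intro i j h
    simp only [v] at h
    rw [div_eq_div_iff (by positivity) (by positivity)] at h
    have h' := mul_left_cancel₀ hδ.ne' h
    ext
    have : ((j : ℕ) : ℝ) = (i : ℕ) := by linarith
    exact_mod_cast this.symm
  obtain ⟨c, hc⟩ := exists_extrapolation_coeff v hvinj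
  have hdet : ∀ x, (1 + (1 : ℝ) • D x).det = ∑ i, c i * (1 + v i • D x).det := by
    intro x
    obtain ⟨p, hp, hpe⟩ := exists_polynomial_eval_eq_det_one_add_smul (D x)
    rw [← hpe, hc p hp]
    simp [hpe]
  have hInt : ∀ t : ℝ, IntegrableOn (fun x => (1 + t • D x).det) B := by
    intro t
    have hcont : Continuous fun x => (1 + t • D x).det :=
      ContinuousLinearMap.continuous_det.comp (continuous_const.add (hDc.const_smul t))
    exact (hcont.continuousOn.integrableOn_compact (isCompact_closedBall 0 R)).mono_set
      Metric.ball_subset_closedBall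
  have hone : ∑ i, c i = 1 := by
    have := hc 1 (by simp)
    simpa using this.symm
  have htot : ∫ x in B, (1 + (1 : ℝ) • D x).det = volume.real B := by
    simp only [hdet]
    rw [integral_finsetSum _ (fun i _ => (hInt (v i)).const_mul _)]
    simp only [integral_const_mul, hvol _ (hvpos _) (hvle _)]
    rw [← Finset.sum_mul, hone, one_mul]
  have hzero : ∀ x, (1 + (1 : ℝ) • D x).det = 0 := by
    intro x
    have hD : 1 + (1 : ℝ) • D x = fderiv ℝ r x := by simp [D]
    rw [hD]
    by_contra hne
    have hx0 : r x ≠ 0 := by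
      intro h; have := hn x; rw [h, norm_zero] at this; exact hR.ne this
    have horth : ∀ w, inner ℝ (r x) (fderiv ℝ r x w) = 0 := by
      intro w
      have hdr := ((hr.differentiable one_ne_zero) x).hasFDerivAt
      have h1 := hdr.norm_sq
      have h2 : (fun y => ‖r y‖ ^ 2) = fun _ => R ^ 2 := by ext y; rw [hn]
      rw [h2] at h1
      have h3 := h1.unique (hasFDerivAt_const (R ^ 2) x)
      have h4 := congrArg (fun T : E →L[ℝ] ℝ => T w) h3
      simpa using h4
    have hu : IsUnit (LinearMap.det (fderiv ℝ r x : E →ₗ[ℝ] E)) := by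
      rw [isUnit_iff_ne_zero]; exact hne
    have hsurj := (LinearMap.equivOfDetNeZero (fderiv ℝ r x : E →ₗ[ℝ] E) hu.ne_zero).surjective
    obtain ⟨w, hw⟩ := hsurj (r x)
    have hw' : fderiv ℝ r x w = r x := hw
    have := horth w
    rw [hw'] at this
    exact hx0 (inner_self_eq_zero.1 this)
  simp only [hzero, integral_zero] at htot
  have hBpos : 0 < volume.real B :=
    ENNReal.toReal_pos (Metric.measure_ball_pos volume 0 hR).ne' measure_ball_lt_top.ne
  exact hBpos.ne htot

/-- A continuous vector field pointing outwards on the unit sphere has a zero. -/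
theorem exists_zero_of_inner_pos_on_sphere (F : E → E) (hF : Continuous F)
    (hs : ∀ x, ‖x‖ = 1 → 0 < inner ℝ (F x) x) : ∃ x, F x = 0 := by
  by_contra! hne
  let _ : MeasurableSpace E := borel E
  have _ : BorelSpace E := ⟨rfl⟩
  let α : E → ℝ := fun x => max 0 (min 1 (‖x‖ - 1))
  let P : E → E := fun x => (max 1 ‖x‖)⁻¹ • x
  let G : E → E := fun x => (1 - α x) • F (P x) + α x • x
  have hm : ∀ x : E, 0 < max 1 ‖x‖ := fun x => lt_max_of_lt_left one_pos
  have hαc : Continuous α := by fun_prop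
  have hPc : Continuous P := by
    refine Continuous.smul (Continuous.inv₀ (by fun_prop) fun x => (hm x).ne') continuous_id
  have hGc : Continuous G := by
    have := hF.comp hPc
    exact ((continuous_const.sub hαc).smul this).add (hαc.smul continuous_id)
  have hα0 : ∀ x, 0 ≤ α x := fun x => le_max_left _ _
  have hα1 : ∀ x, α x ≤ 1 := fun x => max_le zero_le_one (min_le_left _ _)
  have hGout : ∀ x, 2 ≤ ‖x‖ → G x = x := by
    intro x hx
    have : α x = 1 := by
      simp only [α]; rw [min_eq_left (by linarith), max_eq_right zero_le_one]
    simp [G, this]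
  have hGne : ∀ x, G x ≠ 0 := by
    intro x
    rcases le_or_gt ‖x‖ 1 with hx | hx
    · have : α x = 0 := by
        simp only [α]; rw [max_eq_left]; exact (min_le_right _ _).trans (by linarith)
      simp only [G, this, sub_zero, one_smul, zero_smul, add_zero]
      exact hne _
    · intro h0
      have hPn : ‖P x‖ = 1 := by
        simp only [P]
        rw [max_eq_right hx.le, norm_smul, norm_inv, norm_norm, inv_mul_cancel₀ (by linarith)]
      have h1 := hs _ hPn
      have hx' : P x = ‖x‖⁻¹ • x := by simp only [P]; rw [max_eq_right hx.le]
      have h2 : 0 < inner ℝ (F (P x)) x := by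
        nth_rewrite 2 [hx'] at h1
        rw [inner_smul_right] at h1
        exact (pos_iff_pos_of_mul_pos h1).1 (by positivity)
      have h3 : inner ℝ (G x) x = (1 - α x) * inner ℝ (F (P x)) x + α x * ‖x‖ ^ 2 := by
        simp only [G, inner_add_left, inner_smul_left, real_inner_self_eq_norm_sq]
        simp
      rw [h0, inner_zero_left] at h3
      have h4 := hα0 x
      have h5 := hα1 x
      have h6 : 0 < ‖x‖ ^ 2 := by positivity
      have h7 : 0 ≤ (1 - α x) * inner ℝ (F (P x)) x := mul_nonneg (by linarith) h2.le
      have h8 : 0 ≤ α x * ‖x‖ ^ 2 := by positivity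
      have h9 : α x * ‖x‖ ^ 2 = 0 := by linarith
      have h10 : α x = 0 := by simpa [h6.ne'] using h9
      rw [h10] at h3
      simp at h3
      linarith
  -- a uniform lower bound
  obtain ⟨ε, hε, hεG⟩ : ∃ ε > 0, ∀ x, ε ≤ ‖G x‖ := by
    obtain ⟨x₀, _, hx₀⟩ := (isCompact_closedBall (0 : E) 2).exists_isMinOn
      ⟨0, by simp⟩ hGc.norm.continuousOn
    refine ⟨min ‖G x₀‖ 2, lt_min (norm_pos_iff.2 (hGne x₀)) two_pos, fun x => ?_⟩
    rcases le_or_gt ‖x‖ 2 with hx | hx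
    · exact (min_le_left _ _).trans (hx₀ (by simpa using hx))
    · rw [hGout x hx.le]; exact (min_le_right _ _).trans hx.le
  -- mollification
  let g₀ : E → E := fun x => G x - x
  have hg₀c : Continuous g₀ := hGc.sub continuous_id
  have hg₀out : ∀ x, 2 ≤ ‖x‖ → g₀ x = 0 := fun x hx => by simp [g₀, hGout x hx]
  have hg₀s : HasCompactSupport g₀ :=
    HasCompactSupport.intro (isCompact_closedBall 0 2) fun x hx => hg₀out x (by
      simp at hx; exact hx.le)
  obtain ⟨δ, hδ, hunif⟩ := Metric.uniformContinuous_iff.1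
    (hg₀s.uniformContinuous_of_continuous hg₀c) (ε / 2) (by positivity)
  let φ : ContDiffBump (0 : E) :=
    ⟨min δ 1 / 2, min δ 1, by positivity, half_lt_self (by positivity)⟩
  let g₁ : E → E := convolution (φ.normed volume) g₀ (ContinuousLinearMap.lsmul ℝ ℝ) volume
  have hg₁s : ContDiff ℝ 1 g₁ :=
    HasCompactSupport.contDiff_convolution_left _ φ.hasCompactSupport_normed
      (φ.contDiff_normed) hg₀c.locallyIntegrable
  have hg₁d : ∀ x, dist (g₁ x) (g₀ x) ≤ ε / 2 := by
    intro x
    refine φ.dist_normed_convolution_le hg₀c.aestronglyMeasurable fun y hy => ?_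
    exact (hunif (lt_of_lt_of_le (Metric.mem_ball.1 hy) (min_le_left _ _))).le
  have hg₁out : ∀ x, 3 ≤ ‖x‖ → g₁ x = 0 := by
    intro x hx
    have h0 : ∀ y ∈ Metric.ball x φ.rOut, g₀ y = 0 := by
      intro y hy
      apply hg₀out
      have h1 : dist y x < 1 := lt_of_lt_of_le (Metric.mem_ball.1 hy) (min_le_right _ _)
      rw [dist_eq_norm] at h1
      have h2 : ‖x‖ ≤ ‖y‖ + ‖y - x‖ := by
        have := norm_sub_le y (y - x); simpa using this
      linarith
    have hx0 := h0 x (Metric.mem_ball_self φ.rOut_pos)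
    have := φ.dist_normed_convolution_le (μ := volume) (x₀ := x) (ε := 0)
      hg₀c.aestronglyMeasurable fun y hy => by rw [h0 y hy, hx0, dist_self]
    rw [hx0, dist_zero_right] at this
    exact norm_le_zero_iff.1 this
  let H : E → E := fun x => x + g₁ x
  have hHs : ContDiff ℝ 1 H := contDiff_id.add hg₁s
  have hHne : ∀ x, H x ≠ 0 := by
    intro x h
    have h1 := hg₁d x
    have h2 : g₁ x - g₀ x = - G x := by
      have : g₁ x = -x := by rw [eq_neg_iff_add_eq_zero, add_comm]; exact h
      rw [this]; simp only [g₀]; abel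
    rw [dist_eq_norm, h2, norm_neg] at h1
    linarith [hεG x]
  refine not_exists_contDiff_retraction_sphere (R := 3) (by norm_num)
    (fun x => (3 / ‖H x‖) • H x) ?_ ?_ ?_
  · exact (contDiff_const.div (hHs.norm ℝ hHne) fun x => norm_ne_zero_iff.2 (hHne x)).smul hHs
  · intro x
    have : ‖H x‖ ≠ 0 := norm_ne_zero_iff.2 (hHne x)
    rw [norm_smul, Real.norm_of_nonneg (by positivity)]
    field_simp
  · intro x hx
    have : H x = x := by simp [H, hg₁out x hx.ge]
    simp [this, hx]

end Brouwer

section Bernstein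

/-- The geometric sum of the powers of an integer power of a root of unity. -/
lemma sum_zpow_pow_root_of_unity {ζ : ℂ} {M : ℕ} (hζ : IsPrimitiveRoot ζ M) {l : ℤ}
    (hl : ¬ (M : ℤ) ∣ l) : ∑ j ∈ Finset.range M, (ζ ^ j) ^ l = 0 := by
  have h1 : ζ ^ l ≠ 1 := fun h => hl ((hζ.zpow_eq_one_iff_dvd l).1 h)
  have h2 : ∀ j ∈ Finset.range M, (ζ ^ j) ^ l = (ζ ^ l) ^ j := fun j _ => by
    rw [← zpow_natCast, ← zpow_natCast, ← zpow_mul, ← zpow_mul, mul_comm]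
  rw [Finset.sum_congr rfl h2, geom_sum_eq h1]
  have : (ζ ^ l) ^ M = 1 := by
    rw [← zpow_natCast, ← zpow_mul, mul_comm, zpow_mul, zpow_natCast, hζ.pow_eq_one, one_zpow]
  simp [this]

/-- An interpolation formula of M. Riesz type: differentiation of trigonometric polynomials of
degree at most `n` is a combination of translations with total coefficient mass `2 n`. -/
lemma exists_riesz_coeff (n : ℕ) (hn : 1 ≤ n) :
    ∃ (c u : ℕ → ℝ), (∑ j ∈ Finset.range (3 * n), |c j| ≤ 2 * n) ∧
      ∀ k : ℕ, k ≤ n → ∑ j ∈ Finset.range (3 * n),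
        (c j : ℂ) * Complex.exp (Complex.I * u j) ^ k = Complex.I * k := by
  set M := 3 * n with hM
  have hM0 : M ≠ 0 := by omega
  have hMC : (M : ℂ) ≠ 0 := by exact_mod_cast hM0
  set ζ : ℂ := Complex.exp (2 * π * Complex.I / M) with hζdef
  have hζ : IsPrimitiveRoot ζ M := Complex.isPrimitiveRoot_exp M hM0
  let u : ℕ → ℝ := fun j => 2 * π * j / M
  have hz : ∀ j, Complex.exp (Complex.I * u j) = ζ ^ j := by
    intro j
    rw [hζdef, ← Complex.exp_nat_mul]
    congr 1
    simp only [u]; push_cast; ring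
  let D : ℕ → ℂ := fun j => ∑ a ∈ Finset.range n, (ζ ^ j) ^ a
  let c : ℕ → ℝ := fun j => 2 / M * Real.sin (n * u j) * Complex.normSq (D j)
  have hzne : ∀ j, ζ ^ j ≠ 0 := fun j => pow_ne_zero _ (Complex.exp_ne_zero _)
  have hnorm : ∀ j, ‖ζ ^ j‖ = 1 := by
    intro j
    rw [← hz, mul_comm]; exact Complex.norm_exp_ofReal_mul_I _
  have hconj : ∀ j, (starRingEnd ℂ) (ζ ^ j) = (ζ ^ j)⁻¹ := by
    intro j
    rw [Complex.inv_def, Complex.normSq_eq_norm_sq, hnorm]; simp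
  have hDD : ∀ j, (Complex.normSq (D j) : ℂ) =
      ∑ a ∈ Finset.range n, ∑ b ∈ Finset.range n, (ζ ^ j) ^ ((a : ℤ) - b) := by
    intro j
    rw [← Complex.mul_conj]
    simp only [D, map_sum, map_pow]
    rw [show (starRingEnd ℂ) ζ ^ j = (ζ ^ j)⁻¹ by rw [← hconj, map_pow], Finset.sum_mul_sum]
    refine Finset.sum_congr rfl fun a _ => Finset.sum_congr rfl fun b _ => ?_
    rw [zpow_sub₀ (hzne j), zpow_natCast, zpow_natCast, inv_pow, div_eq_mul_inv]
  have hsin : ∀ j, (Real.sin (n * u j) : ℂ) =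
      ((ζ ^ j) ^ (n : ℤ) - (ζ ^ j) ^ (-(n : ℤ))) / (2 * Complex.I) := by
    intro j
    rw [← hz, ← Complex.exp_int_mul, ← Complex.exp_int_mul, Complex.ofReal_sin, Complex.sin]
    have hI : Complex.I ≠ 0 := Complex.I_ne_zero
    field_simp
    rw [Complex.I_sq]
    push_cast
    ring_nf
  refine ⟨c, u, ?_, fun k hk => ?_⟩
  · have h1 : ∀ j ∈ Finset.range M, |c j| ≤ 2 / M * Complex.normSq (D j) := by
      intro j _
      simp only [c]
      rw [abs_mul, abs_mul, abs_of_nonneg (Complex.normSq_nonneg _),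
        abs_of_nonneg (by positivity : (0 : ℝ) ≤ 2 / M)]
      have := Real.abs_sin_le_one (n * u j)
      have h3 := Complex.normSq_nonneg (D j)
      have h4 : (0 : ℝ) ≤ 2 / M := by positivity
      calc _ ≤ 2 / M * 1 * Complex.normSq (D j) := by gcongr
        _ = _ := by ring
    refine (Finset.sum_le_sum h1).trans ?_
    rw [← Finset.mul_sum]
    have h2 : (∑ j ∈ Finset.range M, (Complex.normSq (D j) : ℂ)) = M * n := by
      simp only [hDD]
      rw [Finset.sum_comm]
      have h3 : ∀ a ∈ Finset.range n, ∑ j ∈ Finset.range M, ∑ b ∈ Finset.range n,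
          (ζ ^ j) ^ ((a : ℤ) - b) = M := by
        intro a ha
        rw [Finset.sum_comm, Finset.sum_eq_single a]
        · simp
        · intro b hb hba
          apply sum_zpow_pow_root_of_unity hζ
          intro hd
          rw [Finset.mem_range] at ha hb
          have := Int.eq_zero_of_abs_lt_dvd hd (by rw [abs_lt]; constructor <;> omega)
          omega
        · intro h; exact absurd ha h
      rw [Finset.sum_congr rfl h3]
      simp [mul_comm]
    have h4 : (∑ j ∈ Finset.range M, Complex.normSq (D j)) = M * n := by exact_mod_cast h2
    rw [h4]
    have : (M : ℝ) ≠ 0 := by exact_mod_cast hM0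
    apply le_of_eq
    field_simp
  · simp only [hz]
    have hterm : ∀ j ∈ Finset.range M, (c j : ℂ) * (ζ ^ j) ^ k =
        1 / (M * Complex.I) * ∑ b ∈ Finset.range n, ∑ a ∈ Finset.range n,
          ((ζ ^ j) ^ ((k : ℤ) + n + a - b) - (ζ ^ j) ^ ((k : ℤ) - n + a - b)) := by
      intro j _
      simp only [c]
      push_cast
      have := hsin j
      push_cast at this
      rw [this, hDD, Finset.sum_comm, Finset.mul_sum, Finset.sum_mul, Finset.mul_sum]
      refine Finset.sum_congr rfl fun a _ => ?_
      rw [Finset.mul_sum, Finset.sum_mul, Finset.mul_sum]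
      refine Finset.sum_congr rfl fun b _ => ?_
      rw [show (k : ℤ) + n + b - a = k + n + (b - a) by ring,
        show (k : ℤ) - n + b - a = k + (-n) + (b - a) by ring]
      rw [zpow_add₀ (hzne j), zpow_add₀ (hzne j), zpow_add₀ (hzne j), zpow_add₀ (hzne j),
        zpow_natCast _ k]
      field_simp
    rw [Finset.sum_congr rfl hterm, ← Finset.mul_sum, Finset.sum_comm]
    have hb : ∀ b ∈ Finset.range n, ∑ j ∈ Finset.range M, ∑ a ∈ Finset.range n,
        ((ζ ^ j) ^ ((k : ℤ) + n + a - b) - (ζ ^ j) ^ ((k : ℤ) - n + a - b)) =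
        if b < k then -(M : ℂ) else 0 := by
      intro b hb
      rw [Finset.mem_range] at hb
      rw [Finset.sum_comm]
      simp only [Finset.sum_sub_distrib]
      rw [Finset.sum_eq_zero (s := Finset.range n) (f := fun a =>
        ∑ j ∈ Finset.range M, (ζ ^ j) ^ ((k : ℤ) + n + a - b)), zero_sub]
      · split_ifs with hbk
        · rw [Finset.sum_eq_single (n + b - k)]
          · have : (k : ℤ) - n + ((n + b - k : ℕ) : ℤ) - b = 0 := by omega
            simp [this]
          · intro a ha hne
            rw [Finset.mem_range] at ha
            apply sum_zpow_pow_root_of_unity hζ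
            intro hd
            have := Int.eq_zero_of_abs_lt_dvd hd (by rw [abs_lt]; constructor <;> omega)
            omega
          · intro h; exact absurd (Finset.mem_range.2 (by omega)) h
        · rw [neg_eq_zero]
          apply Finset.sum_eq_zero
          intro a ha
          rw [Finset.mem_range] at ha
          apply sum_zpow_pow_root_of_unity hζ
          intro hd
          have := Int.eq_zero_of_abs_lt_dvd hd (by rw [abs_lt]; constructor <;> omega)
          omega
      · intro a ha
        rw [Finset.mem_range] at ha
        apply sum_zpow_pow_root_of_unity hζ
        intro hd
        have := Int.eq_zero_of_abs_lt_dvd hd (by rw [abs_lt]; constructor <;> omega)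
        omega
    rw [Finset.sum_congr rfl hb, ← Finset.sum_filter]
    have hf : (Finset.range n).filter (fun b => b < k) = Finset.range k := by
      ext b; simp only [Finset.mem_filter, Finset.mem_range]; omega
    rw [hf, Finset.sum_const, Finset.card_range, nsmul_eq_mul]
    have hI : Complex.I ≠ 0 := Complex.I_ne_zero
    field_simp
    rw [Complex.I_sq, neg_one_mul]

/-- Differentiation of a polynomial in `cos θ` as a bounded combination of translations. -/
lemma exists_riesz_formula (n : ℕ) (hn : 1 ≤ n) :
    ∃ (c u : ℕ → ℝ), (∑ j ∈ Finset.range (3 * n), |c j| ≤ 2 * n) ∧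
      ∀ g : Polynomial ℝ, g.natDegree ≤ n → ∀ θ : ℝ,
        HasDerivAt (fun θ => g.eval (cos θ))
          (∑ j ∈ Finset.range (3 * n), c j * g.eval (cos (θ + u j))) θ := by
  obtain ⟨c, u, hc, h⟩ := exists_riesz_coeff n hn
  refine ⟨c, u, hc, fun g hg => ?_⟩
  have hbase : ∀ k : ℕ, k ≤ n → ∀ θ : ℝ, HasDerivAt (fun θ : ℝ => cos (k * θ))
      (∑ j ∈ Finset.range (3 * n), c j * cos (k * (θ + u j))) θ := by
    intro k hk θ
    have h1 : HasDerivAt (fun θ : ℝ => cos (k * θ)) (-sin (k * θ) * (k * 1)) θ :=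
      ((hasDerivAt_id θ).const_mul (k : ℝ)).cos
    convert h1 using 1
    have h2 := congrArg (fun z => (z * Complex.exp (Complex.I * (k * θ : ℝ))).re) (h k hk)
    simp only [Finset.sum_mul, Complex.re_sum] at h2
    convert h2 using 1
    · refine Finset.sum_congr rfl fun j _ => ?_
      rw [mul_assoc, ← Complex.exp_nat_mul, ← Complex.exp_add, Complex.re_ofReal_mul,
        show (k : ℂ) * (Complex.I * u j) + Complex.I * (k * θ : ℝ) =
          ((k * (θ + u j) : ℝ) : ℂ) * Complex.I by push_cast; ring, Complex.exp_ofReal_mul_I_re]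
    · rw [mul_comm Complex.I (k * θ : ℝ), Complex.exp_mul_I, ← Complex.ofReal_cos,
        ← Complex.ofReal_sin]
      simp only [Complex.mul_re, Complex.mul_im, Complex.add_re, Complex.add_im, Complex.I_re,
        Complex.I_im, Complex.natCast_re, Complex.natCast_im, Complex.ofReal_re, Complex.ofReal_im]
      ring
  have hprod : ∀ p k : ℕ, p + k ≤ n → ∀ θ : ℝ, HasDerivAt (fun θ : ℝ => cos θ ^ p * cos (k * θ))
      (∑ j ∈ Finset.range (3 * n), c j * (cos (θ + u j) ^ p * cos (k * (θ + u j)))) θ := by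
    intro p
    induction p with
    | zero => intro k hk θ; simpa using hbase k (by omega) θ
    | succ p ih =>
      intro k hk θ
      rcases k with _ | k
      · have h1 := ih 1 (by omega) θ
        simpa [pow_succ] using h1
      · have h1 := (ih (k + 2) (by omega) θ).add (ih k (by omega) θ)
        have h2 := h1.const_mul (1 / 2 : ℝ)
        have key : ∀ x : ℝ, cos x ^ (p + 1) * cos ((k + 1 : ℕ) * x) =
            1 / 2 * (cos x ^ p * cos ((k + 2 : ℕ) * x) + cos x ^ p * cos (k * x)) := by
          intro x
          push_cast
          rw [show ((k : ℝ) + 2) * x = (k + 1) * x + x by ring,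
            show (k : ℝ) * x = (k + 1) * x - x by ring, cos_add, cos_sub]
          ring
        simp only [key]
        refine h2.congr_deriv ?_
        rw [← Finset.sum_add_distrib, Finset.mul_sum]
        refine Finset.sum_congr rfl fun j _ => by ring
  intro θ
  simp only [Polynomial.eval_eq_sum_range]
  have h1 : HasDerivAt (fun θ : ℝ => ∑ i ∈ Finset.range (g.natDegree + 1), g.coeff i * cos θ ^ i)
      (∑ i ∈ Finset.range (g.natDegree + 1), g.coeff i *
        ∑ j ∈ Finset.range (3 * n), c j * (cos (θ + u j) ^ i)) θ := by
    refine HasDerivAt.fun_sum fun i hi => HasDerivAt.const_mul _ ?_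
    rw [Finset.mem_range] at hi
    simpa using hprod i 0 (by omega) θ
  convert h1 using 1
  simp only [Finset.mul_sum]
  rw [Finset.sum_comm]
  refine Finset.sum_congr rfl fun i _ => Finset.sum_congr rfl fun j _ => by ring

lemma integral_zero_two_pi_of_symm {f : ℝ → ℝ} (hf : Continuous f)
    (hs : ∀ θ, f (2 * π - θ) = f θ) :
    ∫ θ in (0 : ℝ)..(2 * π), f θ = 2 * ∫ θ in (0 : ℝ)..π, f θ := by
  rw [← intervalIntegral.integral_add_adjacent_intervals (hf.intervalIntegrable 0 π)
    (hf.intervalIntegrable π (2 * π))]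
  have h : ∫ θ in (0 : ℝ)..π, f (2 * π - θ) = ∫ θ in (2 * π - π)..(2 * π - 0), f θ :=
    intervalIntegral.integral_comp_sub_left f (2 * π)
  simp only [hs] at h
  rw [show 2 * π - π = π by ring, sub_zero] at h
  rw [← h]; ring

/-- Bernstein's inequality in `L¹`, up to the constant. -/
theorem integral_abs_deriv_cos_le (n : ℕ) (hn : 1 ≤ n) (g : Polynomial ℝ) (hg : g.natDegree ≤ n) :
    ∫ θ in (0 : ℝ)..π, |g.derivative.eval (cos θ) * sin θ| ≤
      2 * n * ∫ θ in (0 : ℝ)..π, |g.eval (cos θ)| := by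
  obtain ⟨c, u, hc, h⟩ := exists_riesz_formula n hn
  have hT : Continuous fun θ : ℝ => |g.eval (cos θ)| := by fun_prop
  have hT' : Continuous fun θ : ℝ => |g.derivative.eval (cos θ) * sin θ| := by fun_prop
  have hd : ∀ θ, g.derivative.eval (cos θ) * sin θ =
      -∑ j ∈ Finset.range (3 * n), c j * g.eval (cos (θ + u j)) := by
    intro θ
    have h1 := (g.hasDerivAt (cos θ)).comp θ (hasDerivAt_cos θ)
    have := h1.unique (h g hg θ)
    linarith
  have hper : ∀ a : ℝ, ∫ θ in (0 : ℝ)..(2 * π), |g.eval (cos (θ + a))| =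
      ∫ θ in (0 : ℝ)..(2 * π), |g.eval (cos θ)| := by
    intro a
    rw [intervalIntegral.integral_comp_add_right (fun θ => |g.eval (cos θ)|) a]
    have hp : Function.Periodic (fun θ : ℝ => |g.eval (cos θ)|) (2 * π) := fun θ => by simp
    have := hp.intervalIntegral_add_eq (0 + a) 0
    rw [zero_add, zero_add] at this
    rw [zero_add, add_comm (2 * π) a]
    exact this
  have hfull : ∫ θ in (0 : ℝ)..(2 * π), |g.derivative.eval (cos θ) * sin θ| ≤
      2 * n * ∫ θ in (0 : ℝ)..(2 * π), |g.eval (cos θ)| := by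
    calc _ ≤ ∫ θ in (0 : ℝ)..(2 * π), ∑ j ∈ Finset.range (3 * n),
          |c j| * |g.eval (cos (θ + u j))| := by
          refine intervalIntegral.integral_mono_on (by positivity) (hT'.intervalIntegrable _ _)
            (Continuous.intervalIntegrable (by fun_prop) _ _) fun θ _ => ?_
          rw [hd, abs_neg]
          refine (Finset.abs_sum_le_sum_abs _ _).trans (le_of_eq ?_)
          simp only [abs_mul]
      _ = ∑ j ∈ Finset.range (3 * n), |c j| * ∫ θ in (0 : ℝ)..(2 * π), |g.eval (cos θ)| := by
          rw [intervalIntegral.integral_finsetSum fun j _ =>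
            Continuous.intervalIntegrable (by fun_prop) _ _]
          simp only [intervalIntegral.integral_const_mul, hper]
      _ ≤ _ := by
          rw [← Finset.sum_mul]
          exact mul_le_mul_of_nonneg_right hc
            (intervalIntegral.integral_nonneg (by positivity) fun _ _ => abs_nonneg _)
  rw [integral_zero_two_pi_of_symm hT (fun θ => by rw [cos_two_pi_sub]),
    integral_zero_two_pi_of_symm hT' (fun θ => by
      rw [cos_two_pi_sub, sin_two_pi_sub, mul_neg, abs_neg])] at hfull
  linarith

end Bernstein

section Doubling

/-- Doubling of a measure on balls centred in `[-1,1]`. -/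
def IsDoublingMeasure (μ : Measure ℝ) (L : ℝ) : Prop :=
  ∀ δ : ℝ, 0 < δ → ∀ a ∈ Icc (-1 : ℝ) 1,
    μ.real (Icc (a - 2 * δ) (a + 2 * δ)) ≤ L * μ.real (Icc (a - δ) (a + δ))

variable {μ : Measure ℝ} {L : ℝ}

lemma IsDoublingMeasure.two_pow (hd : IsDoublingMeasure μ L) (hL : 0 ≤ L) (k : ℕ) {δ a : ℝ}
    (hδ : 0 < δ) (ha : a ∈ Icc (-1 : ℝ) 1) :
    μ.real (Icc (a - 2 ^ k * δ) (a + 2 ^ k * δ)) ≤ L ^ k * μ.real (Icc (a - δ) (a + δ)) := by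
  induction k with
  | zero => simp
  | succ k ih =>
    have h := hd (2 ^ k * δ) (by positivity) a ha
    rw [← mul_assoc, ← pow_succ'] at h
    calc _ ≤ L * μ.real (Icc (a - 2 ^ k * δ) (a + 2 ^ k * δ)) := h
      _ ≤ L * (L ^ k * μ.real (Icc (a - δ) (a + δ))) := by gcongr
      _ = _ := by ring

variable [IsFiniteMeasure μ]

lemma IsDoublingMeasure.le_of_subset (hd : IsDoublingMeasure μ L) (hL : 0 ≤ L) (k : ℕ)
    {δ a b r : ℝ} (hδ : 0 < δ) (ha : a ∈ Icc (-1 : ℝ) 1) (h : |b - a| + r ≤ 2 ^ k * δ) :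
    μ.real (Icc (b - r) (b + r)) ≤ L ^ k * μ.real (Icc (a - δ) (a + δ)) := by
  refine le_trans (measureReal_mono ?_) (hd.two_pow hL k hδ ha)
  have h1 := abs_le.1 (le_refl |b - a|)
  exact Icc_subset_Icc (by linarith) (by linarith)

/-- Every ball centred in `[-1,1]` has a definite portion of the total mass. -/
lemma IsDoublingMeasure.total_le (hd : IsDoublingMeasure μ L) (hL : 0 ≤ L)
    (hs : ∀ᵐ x ∂μ, x ∈ Icc (-1 : ℝ) 1) (k : ℕ) {δ a : ℝ} (hδ : 0 < δ)
    (ha : a ∈ Icc (-1 : ℝ) 1) (h : 2 ≤ 2 ^ k * δ) :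
    μ.real univ ≤ L ^ k * μ.real (Icc (a - δ) (a + δ)) := by
  have h1 : μ.real univ ≤ μ.real (Icc (a - 2 ^ k * δ) (a + 2 ^ k * δ)) := by
    refine ENNReal.toReal_mono (measure_ne_top _ _) (measure_mono_ae ?_)
    filter_upwards [hs] with x hx _
    exact ⟨by linarith [hx.1, ha.2], by linarith [hx.2, ha.1]⟩
  exact h1.trans (hd.two_pow hL k hδ ha)

lemma IsDoublingMeasure.pos (hd : IsDoublingMeasure μ L) (hL : 0 ≤ L)
    (hs : ∀ᵐ x ∂μ, x ∈ Icc (-1 : ℝ) 1) (hW : 0 < μ.real univ) {δ a : ℝ} (hδ : 0 < δ)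
    (ha : a ∈ Icc (-1 : ℝ) 1) : 0 < μ.real (Icc (a - δ) (a + δ)) := by
  obtain ⟨k, hk⟩ := pow_unbounded_of_one_lt (2 / δ) (one_lt_two (α := ℝ))
  have h := hd.total_le hL hs k hδ ha (by rw [div_lt_iff₀ hδ] at hk; exact hk.le)
  have h2 : 0 < L ^ k * μ.real (Icc (a - δ) (a + δ)) := hW.trans_le h
  exact pos_of_mul_pos_right h2 (by positivity)

lemma integrable_of_continuous_of_ae_mem (hs : ∀ᵐ x ∂μ, x ∈ Icc (-1 : ℝ) 1) {f : ℝ → ℝ}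
    (hf : Continuous f) : Integrable f μ := by
  obtain ⟨C, hC⟩ := isCompact_Icc.exists_bound_of_continuousOn (s := Icc (-1 : ℝ) 1)
    hf.continuousOn
  exact Integrable.of_bound hf.aestronglyMeasurable C (hs.mono fun x hx => hC x hx)

/-- Integrals of functions with fast decay are controlled by the mass of a ball. -/
lemma IsDoublingMeasure.integral_le_of_decay (hd : IsDoublingMeasure μ L) (hL : 0 ≤ L)
    (hs : ∀ᵐ x ∂μ, x ∈ Icc (-1 : ℝ) 1) {k : ℕ} (hk : 2 * L ≤ 2 ^ k) {f : ℝ → ℝ}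
    (hf : Continuous f) {A δ a : ℝ} (hδ : 0 < δ) (ha : a ∈ Icc (-1 : ℝ) 1)
    (h1 : ∀ x ∈ Icc (-1 : ℝ) 1, f x ≤ A)
    (h2 : ∀ x ∈ Icc (-1 : ℝ) 1, f x * |x - a| ^ k ≤ A * δ ^ k) (hA : 0 ≤ A) :
    ∫ x, f x ∂μ ≤ 2 ^ (k + 1) * A * μ.real (Icc (a - δ) (a + δ)) := by
  obtain ⟨J, hJ⟩ := pow_unbounded_of_one_lt (2 / δ) (one_lt_two (α := ℝ))
  rw [div_lt_iff₀ hδ] at hJ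
  let S : ℕ → Set ℝ := fun j => Icc (a - 2 ^ j * δ) (a + 2 ^ j * δ)
  let G : ℝ → ℝ := fun x => ∑ j ∈ Finset.range (J + 1),
    (S j).indicator (fun _ => A * 2 ^ k * (1 / 2 ^ k) ^ j) x
  have hpt : ∀ x ∈ Icc (-1 : ℝ) 1, f x ≤ G x := by
    intro x hx
    have hmem : ∀ j, x ∈ S j ↔ |x - a| ≤ 2 ^ j * δ := fun j => by
      rw [abs_le]; constructor
      · intro h; exact ⟨by linarith [h.1], by linarith [h.2]⟩
      · intro h; exact ⟨by linarith [h.1], by linarith [h.2]⟩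
    have hex : ∃ j, |x - a| ≤ 2 ^ j * δ :=
      ⟨J, by rw [abs_le]; constructor <;> linarith [hx.1, hx.2, ha.1, ha.2]⟩
    classical
    set j := Nat.find hex with hj
    have hjs : |x - a| ≤ 2 ^ j * δ := Nat.find_spec hex
    have hjJ : j ≤ J := Nat.find_min' hex (by
      rw [abs_le]; constructor <;> linarith [hx.1, hx.2, ha.1, ha.2])
    have hterm : f x ≤ (S j).indicator (fun _ => A * 2 ^ k * (1 / 2 ^ k) ^ j) x := by
      rw [indicator_of_mem ((hmem j).2 hjs)]
      rcases hj0 : j with _ | i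
      · have : (1 : ℝ) ≤ 2 ^ k := one_le_pow₀ one_le_two
        have := h1 x hx
        simp only [pow_zero, mul_one]
        nlinarith
      · have hi : 2 ^ i * δ < |x - a| := by
          have := Nat.find_min hex (m := i) (by omega)
          exact not_le.1 this
        have h3 := h2 x hx
        by_cases hfx : f x ≤ 0
        · exact hfx.trans (by positivity)
        push Not at hfx
        have h4 : f x * (2 ^ i * δ) ^ k ≤ A * δ ^ k := le_trans (by gcongr) h3
        have h5 : f x * (2 ^ k) ^ i ≤ A := by
          rw [mul_pow, ← mul_assoc] at h4
          have := le_of_mul_le_mul_right h4 (by positivity)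
          rwa [← pow_mul, mul_comm k i, pow_mul]
        rw [pow_succ (1 / 2 ^ k : ℝ) i, one_div, inv_pow]
        calc f x ≤ A / (2 ^ k) ^ i := by rw [le_div_iff₀ (by positivity)]; exact h5
          _ = _ := by field_simp
    refine hterm.trans (Finset.single_le_sum (f := fun j =>
      (S j).indicator (fun _ => A * 2 ^ k * (1 / 2 ^ k) ^ j) x) (fun i _ => ?_)
      (Finset.mem_range.2 (by omega)))
    exact indicator_nonneg (fun _ _ => by positivity) x
  have hGi : ∀ j ∈ Finset.range (J + 1),
      Integrable ((S j).indicator (fun _ => A * 2 ^ k * (1 / 2 ^ k : ℝ) ^ j)) μ :=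
    fun j _ => (integrable_const _).indicator measurableSet_Icc
  have hM : 0 ≤ μ.real (Icc (a - δ) (a + δ)) := measureReal_nonneg
  have hkpos : (0 : ℝ) < 2 ^ k := by positivity
  calc ∫ x, f x ∂μ ≤ ∫ x, G x ∂μ :=
        integral_mono_ae (integrable_of_continuous_of_ae_mem hs hf)
          (integrable_finsetSum _ hGi) (hs.mono hpt)
    _ = ∑ j ∈ Finset.range (J + 1), A * 2 ^ k * (1 / 2 ^ k) ^ j * μ.real (S j) := by
        rw [integral_finsetSum _ hGi]
        refine Finset.sum_congr rfl fun j _ => ?_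
        rw [integral_indicator measurableSet_Icc, setIntegral_const, smul_eq_mul, mul_comm]
    _ ≤ ∑ j ∈ Finset.range (J + 1),
          A * 2 ^ k * μ.real (Icc (a - δ) (a + δ)) * (1 / 2) ^ j := by
        refine Finset.sum_le_sum fun j _ => ?_
        have h3 := hd.two_pow hL j hδ ha
        have h4 : (1 / 2 ^ k : ℝ) ^ j * L ^ j ≤ (1 / 2) ^ j := by
          rw [← mul_pow]
          refine pow_le_pow_left₀ (by positivity) ?_ j
          rw [one_div_mul_eq_div, div_le_div_iff₀ hkpos two_pos]; linarith
        calc _ ≤ A * 2 ^ k * (1 / 2 ^ k) ^ j * (L ^ j * μ.real (Icc (a - δ) (a + δ))) := by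
              gcongr
          _ = A * 2 ^ k * μ.real (Icc (a - δ) (a + δ)) * ((1 / 2 ^ k) ^ j * L ^ j) := by ring
          _ ≤ _ := by gcongr
    _ ≤ _ := by
        rw [← Finset.mul_sum]
        have h5 : ∑ j ∈ Finset.range (J + 1), (1 / 2 : ℝ) ^ j ≤ 2 := sum_geometric_two_le _
        calc _ ≤ A * 2 ^ k * μ.real (Icc (a - δ) (a + δ)) * 2 := by gcongr
          _ = _ := by ring

end Doubling

section Kernel

open Polynomial in
/-- The Dirichlet kernel as a polynomial in the cosine. -/
def dirichletPoly (r : ℕ) : Polynomial ℝ :=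
  1 + 2 * ∑ j ∈ Finset.range r, Polynomial.Chebyshev.T ℝ ((j : ℤ) + 1)

lemma natDegree_dirichletPoly_le (r : ℕ) : (dirichletPoly r).natDegree ≤ r := by
  unfold dirichletPoly
  refine (Polynomial.natDegree_add_le _ _).trans (max_le (by simp) ?_)
  refine (Polynomial.natDegree_mul_le).trans ?_
  have h2 : (2 : Polynomial ℝ).natDegree = 0 := Polynomial.natDegree_ofNat 2
  rw [h2, zero_add]
  refine Polynomial.natDegree_sum_le_of_forall_le _ _ fun j hj => ?_
  rw [Finset.mem_range] at hj
  refine (Polynomial.natDegree_le_of_degree_le (n := j + 1) ?_).trans hj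
  rw [Polynomial.Chebyshev.degree_T]
  exact_mod_cast le_of_eq (by omega)

lemma eval_dirichletPoly_cos (r : ℕ) (θ : ℝ) :
    (dirichletPoly r).eval (cos θ) = 1 + 2 * ∑ j ∈ Finset.range r, cos ((j + 1) * θ) := by
  simp only [dirichletPoly, Polynomial.eval_add, Polynomial.eval_mul, Polynomial.eval_one,
    Polynomial.eval_ofNat, Polynomial.eval_finsetSum, Polynomial.Chebyshev.T_real_cos]
  push_cast
  rfl

lemma eval_dirichletPoly_cos_mul_sin (r : ℕ) (θ : ℝ) :
    (dirichletPoly r).eval (cos θ) * sin (θ / 2) = sin ((r + 1 / 2) * θ) := by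
  rw [eval_dirichletPoly_cos]
  induction r with
  | zero => simp; ring_nf
  | succ r ih =>
    rw [Finset.sum_range_succ]
    push_cast
    have h1 : ((r : ℝ) + 1 + 1 / 2) * θ = (r + 1) * θ + θ / 2 := by ring
    have h2 : ((r : ℝ) + 1 / 2) * θ = (r + 1) * θ - θ / 2 := by ring
    rw [h2, sin_sub] at ih
    rw [h1, sin_add]
    linarith

lemma abs_sin_nat_mul_le (j : ℕ) (x : ℝ) : |sin (j * x)| ≤ j * |sin x| := by
  induction j with
  | zero => simp
  | succ j ih =>
    push_cast
    rw [add_mul, one_mul, sin_add]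
    refine (abs_add_le _ _).trans ?_
    rw [abs_mul, abs_mul]
    have h1 := abs_cos_le_one x
    have h2 := abs_cos_le_one (j * x)
    have h3 := abs_nonneg (sin x)
    have h4 := abs_nonneg (sin (j * x))
    nlinarith

lemma dirichletPoly_bounds (r : ℕ) {c : ℝ} (hc : c ∈ Icc (-1 : ℝ) 1) :
    |(dirichletPoly r).eval c| ≤ 2 * r + 1 ∧ (dirichletPoly r).eval c ^ 2 * (1 - c) ≤ 2 ∧
      ((r : ℝ) ^ 2 * (1 - c) ≤ 1 / 2 → (r : ℝ) + 1 ≤ (dirichletPoly r).eval c) := by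
  obtain ⟨θ, rfl⟩ : ∃ θ, cos θ = c := ⟨arccos c, cos_arccos hc.1 hc.2⟩
  have hhalf : 1 - cos θ = 2 * sin (θ / 2) ^ 2 := by
    have := cos_two_mul (θ / 2)
    rw [show 2 * (θ / 2) = θ by ring] at this
    have h2 := sin_sq_add_cos_sq (θ / 2)
    linarith
  refine ⟨?_, ?_, fun h => ?_⟩
  · rw [eval_dirichletPoly_cos]
    refine (abs_add_le _ _).trans ?_
    rw [abs_one, abs_mul, abs_two]
    have : |∑ j ∈ Finset.range r, cos ((j + 1) * θ)| ≤ ∑ j ∈ Finset.range r, (1 : ℝ) :=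
      (Finset.abs_sum_le_sum_abs _ _).trans (Finset.sum_le_sum fun j _ => abs_cos_le_one _)
    simp at this
    linarith
  · rw [hhalf]
    have h1 := eval_dirichletPoly_cos_mul_sin r θ
    have h2 := sin_sq_le_one ((r + 1 / 2) * θ)
    rw [← h1, mul_pow] at h2
    linarith
  · rw [eval_dirichletPoly_cos]
    have h1 : ∀ j ∈ Finset.range r, (1 / 2 : ℝ) ≤ cos ((j + 1) * θ) := by
      intro j hj
      rw [Finset.mem_range] at hj
      have h2 := abs_sin_nat_mul_le (j + 1) (θ / 2)
      have h3 : cos (((j : ℝ) + 1) * θ) = 1 - 2 * sin (((j : ℝ) + 1) * (θ / 2)) ^ 2 := by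
        have := cos_two_mul (((j : ℝ) + 1) * (θ / 2))
        rw [show 2 * (((j : ℝ) + 1) * (θ / 2)) = ((j : ℝ) + 1) * θ by ring] at this
        have h2 := sin_sq_add_cos_sq (((j : ℝ) + 1) * (θ / 2))
        linarith
      have h4 : sin (((j : ℝ) + 1) * (θ / 2)) ^ 2 ≤ ((j : ℝ) + 1) ^ 2 * sin (θ / 2) ^ 2 := by
        rw [← mul_pow, ← sq_abs, ← sq_abs (((j : ℝ) + 1) * sin (θ / 2)), abs_mul,
          abs_of_nonneg (by positivity : (0 : ℝ) ≤ (j : ℝ) + 1)]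
        push_cast at h2
        gcongr
      have h5 : ((j : ℝ) + 1) ^ 2 ≤ (r : ℝ) ^ 2 := by
        have : ((j : ℝ) + 1) ≤ r := by exact_mod_cast hj
        gcongr
      rw [hhalf] at h
      have h6 : 0 ≤ sin (θ / 2) ^ 2 := sq_nonneg _
      have h7 := mul_le_mul_of_nonneg_right h5 h6
      rw [h3]; linarith
    have h2 := Finset.sum_le_sum h1
    simp only [Finset.sum_const, Finset.card_range, nsmul_eq_mul] at h2
    linarith

/-- Polynomial kernels of Jackson type. -/
lemma exists_jackson_kernel (k : ℕ) (hk : 1 ≤ k) :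
    ∃ B : ℝ, 1 ≤ B ∧ ∀ n : ℕ, 1 ≤ n → ∃ P : Polynomial ℝ, P.natDegree + 1 ≤ n ∧
      ∀ c ∈ Icc (-1 : ℝ) 1, 0 ≤ P.eval c ∧ P.eval c ≤ 1 ∧
        P.eval c * ((n : ℝ) ^ 2 * (1 - c)) ^ k ≤ B ∧
        ((n : ℝ) ^ 2 * (1 - c) ≤ 1 / 2 → (1 / 4) ^ k ≤ P.eval c) := by
  have hk1 : (1 : ℝ) ≤ k := by exact_mod_cast hk
  refine ⟨(8 * (k : ℝ) ^ 2) ^ k, one_le_pow₀ (by nlinarith), fun n hn => ?_⟩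
  set r := (n - 1) / (2 * k) with hr
  have hdiv := Nat.div_add_mod (n - 1) (2 * k)
  have hmod := Nat.mod_lt (n - 1) (by omega : 2 * k > 0)
  rw [← hr] at hdiv
  have hrn : r ≤ n := (Nat.div_le_self _ _).trans (by omega)
  have hnr : (n : ℝ) ≤ 2 * k * (2 * r + 1) := by
    have h1 : n ≤ 2 * k * r + 2 * k := by omega
    have h2 : (n : ℝ) ≤ 2 * k * r + 2 * k := by exact_mod_cast h1
    have h3 : (0 : ℝ) ≤ k * r := by positivity
    nlinarith
  have hm : (0 : ℝ) < 2 * r + 1 := by positivity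
  refine ⟨(Polynomial.C ((2 * (r : ℝ) + 1)⁻¹) * dirichletPoly r) ^ (2 * k), ?_, fun c hc => ?_⟩
  · have h1 : ((Polynomial.C ((2 * (r : ℝ) + 1)⁻¹) * dirichletPoly r) ^ (2 * k)).natDegree ≤
        2 * k * r := by
      refine Polynomial.natDegree_pow_le.trans (Nat.mul_le_mul_left _ ?_)
      exact (Polynomial.natDegree_C_mul_le _ _).trans (natDegree_dirichletPoly_le r)
    omega
  · obtain ⟨h1, h2, h3⟩ := dirichletPoly_bounds r hc
    simp only [Polynomial.eval_pow, Polynomial.eval_mul, Polynomial.eval_C]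
    set D := (dirichletPoly r).eval c
    have hc0 : 0 ≤ 1 - c := by linarith [hc.2]
    have hDle : ((2 * (r : ℝ) + 1)⁻¹ * D) ^ 2 ≤ 1 := by
      rw [sq_le_one_iff_abs_le_one, abs_mul, abs_of_nonneg (by positivity),
        inv_mul_le_iff₀ hm]
      linarith
    rw [pow_mul]
    refine ⟨by positivity, pow_le_one₀ (by positivity) hDle, ?_, fun h => ?_⟩
    · rw [← mul_pow]
      refine pow_le_pow_left₀ (by positivity) ?_ k
      rw [mul_pow, inv_pow, inv_mul_eq_div, div_mul_eq_mul_div, div_le_iff₀ (by positivity)]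
      have h4 : (n : ℝ) ^ 2 ≤ (2 * k * (2 * r + 1)) ^ 2 := by gcongr
      have h5 : (n : ℝ) ^ 2 * (D ^ 2 * (1 - c)) ≤ (2 * k * (2 * r + 1)) ^ 2 * 2 := by
        gcongr
      linarith
    · refine pow_le_pow_left₀ (by positivity) ?_ k
      have h4 : (r : ℝ) ^ 2 * (1 - c) ≤ 1 / 2 := by
        refine le_trans ?_ h
        gcongr
      have h5 := h3 h4
      have h6 : (1 / 2 : ℝ) ≤ (2 * (r : ℝ) + 1)⁻¹ * D := by
        rw [inv_mul_eq_div, le_div_iff₀ hm]; linarith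
      nlinarith

/-- The cosine of the difference of the angles of two points of `[-1,1]`. -/
def cosDiff (x y : ℝ) : ℝ := x * y + √(1 - x ^ 2) * √(1 - y ^ 2)

/-- The cosine of the sum of the angles of two points of `[-1,1]`. -/
def cosSum (x y : ℝ) : ℝ := x * y - √(1 - x ^ 2) * √(1 - y ^ 2)

lemma sq_sqrt_one_sub_sq {x : ℝ} (hx : x ∈ Icc (-1 : ℝ) 1) : √(1 - x ^ 2) ^ 2 = 1 - x ^ 2 :=
  Real.sq_sqrt (by nlinarith [hx.1, hx.2])

lemma one_sub_cosDiff {x y : ℝ} (hx : x ∈ Icc (-1 : ℝ) 1) (hy : y ∈ Icc (-1 : ℝ) 1) :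
    1 - cosDiff x y = ((x - y) ^ 2 + (√(1 - x ^ 2) - √(1 - y ^ 2)) ^ 2) / 2 := by
  unfold cosDiff
  linear_combination (1 / 2 : ℝ) * sq_sqrt_one_sub_sq hx * (-1) +
    (1 / 2 : ℝ) * sq_sqrt_one_sub_sq hy * (-1)

lemma one_sub_cosSum {x y : ℝ} (hx : x ∈ Icc (-1 : ℝ) 1) (hy : y ∈ Icc (-1 : ℝ) 1) :
    1 - cosSum x y = ((x - y) ^ 2 + (√(1 - x ^ 2) + √(1 - y ^ 2)) ^ 2) / 2 := by
  unfold cosSum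
  linear_combination (1 / 2 : ℝ) * sq_sqrt_one_sub_sq hx * (-1) +
    (1 / 2 : ℝ) * sq_sqrt_one_sub_sq hy * (-1)

lemma cosSum_le_cosDiff (x y : ℝ) : cosSum x y ≤ cosDiff x y := by
  unfold cosSum cosDiff
  have : 0 ≤ √(1 - x ^ 2) * √(1 - y ^ 2) := by positivity
  linarith

lemma cosDiff_mem {x y : ℝ} (hx : x ∈ Icc (-1 : ℝ) 1) (hy : y ∈ Icc (-1 : ℝ) 1) :
    cosDiff x y ∈ Icc (-1 : ℝ) 1 := by
  constructor
  · unfold cosDiff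
    nlinarith [sq_sqrt_one_sub_sq hx, sq_sqrt_one_sub_sq hy, sq_nonneg (x + y),
      sq_nonneg (√(1 - x ^ 2) + √(1 - y ^ 2))]
  · have := one_sub_cosDiff hx hy
    nlinarith [sq_nonneg (x - y), sq_nonneg (√(1 - x ^ 2) - √(1 - y ^ 2))]

lemma cosSum_mem {x y : ℝ} (hx : x ∈ Icc (-1 : ℝ) 1) (hy : y ∈ Icc (-1 : ℝ) 1) :
    cosSum x y ∈ Icc (-1 : ℝ) 1 := by
  refine ⟨?_, (cosSum_le_cosDiff x y).trans (cosDiff_mem hx hy).2⟩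
  unfold cosSum
  nlinarith [sq_sqrt_one_sub_sq hx, sq_sqrt_one_sub_sq hy, sq_nonneg (x + y),
    sq_nonneg (√(1 - x ^ 2) - √(1 - y ^ 2))]

lemma sq_sub_eq_mul {x y : ℝ} (hx : x ∈ Icc (-1 : ℝ) 1) (hy : y ∈ Icc (-1 : ℝ) 1) :
    (x - y) ^ 2 = (1 - cosDiff x y) * (1 - cosSum x y) := by
  unfold cosDiff cosSum
  linear_combination (√(1 - y ^ 2)) ^ 2 * sq_sqrt_one_sub_sq hx + (1 - x ^ 2) *
    sq_sqrt_one_sub_sq hy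

/-- Symmetrization of a kernel is a polynomial of the same degree. -/
lemma exists_symmetrization (P : Polynomial ℝ) {y : ℝ} (hy : y ∈ Icc (-1 : ℝ) 1) :
    ∃ Q : Polynomial ℝ, Q.natDegree ≤ P.natDegree ∧ ∀ x ∈ Icc (-1 : ℝ) 1,
      Q.eval x = P.eval (cosDiff x y) + P.eval (cosSum x y) := by
  have hpow : ∀ j : ℕ, ∃ Q R : Polynomial ℝ, Q.natDegree ≤ j ∧ R.natDegree ≤ j + 1 ∧
      ∀ x ∈ Icc (-1 : ℝ) 1, Q.eval x = cosDiff x y ^ j + cosSum x y ^ j ∧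
        R.eval x = cosDiff x y ^ (j + 1) + cosSum x y ^ (j + 1) := by
    intro j
    induction j with
    | zero =>
      refine ⟨2, Polynomial.C (2 * y) * Polynomial.X, by simp,
        by compute_degree, fun x _ => ⟨by simp; norm_num, ?_⟩⟩
      simp [cosDiff, cosSum]; ring
    | succ j ih =>
      obtain ⟨Q, R, hQ, hR, h⟩ := ih
      refine ⟨R, Polynomial.C (2 * y) * Polynomial.X * R -
        (Polynomial.X ^ 2 + Polynomial.C (y ^ 2 - 1)) * Q, hR, ?_, fun x hx => ⟨(h x hx).2, ?_⟩⟩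
      · refine (Polynomial.natDegree_sub_le _ _).trans (max_le ?_ ?_)
        · refine Polynomial.natDegree_mul_le.trans ?_
          have : (Polynomial.C (2 * y) * Polynomial.X).natDegree ≤ 1 := by compute_degree
          omega
        · refine Polynomial.natDegree_mul_le.trans ?_
          have : (Polynomial.X ^ 2 + Polynomial.C (y ^ 2 - 1)).natDegree ≤ 2 := by compute_degree
          omega
      · simp only [Polynomial.eval_sub, Polynomial.eval_mul, Polynomial.eval_C,
          Polynomial.eval_X, Polynomial.eval_add, Polynomial.eval_pow, (h x hx).1, (h x hx).2]
        have h1 : 2 * y * x = cosDiff x y + cosSum x y := by unfold cosDiff cosSum; ring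
        have h2 : x ^ 2 + (y ^ 2 - 1) = cosDiff x y * cosSum x y := by
          unfold cosDiff cosSum
          linear_combination (√(1 - y ^ 2)) ^ 2 * sq_sqrt_one_sub_sq hx + (1 - x ^ 2) *
            sq_sqrt_one_sub_sq hy
        rw [h1, h2]; ring
  choose Q R hQ _ h using hpow
  refine ⟨∑ j ∈ Finset.range (P.natDegree + 1), Polynomial.C (P.coeff j) * Q j, ?_,
    fun x hx => ?_⟩
  · refine Polynomial.natDegree_sum_le_of_forall_le _ _ fun j hj => ?_
    rw [Finset.mem_range] at hj
    exact (Polynomial.natDegree_C_mul_le _ _).trans ((hQ j).trans (by omega))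
  · rw [Polynomial.eval_finsetSum, Polynomial.eval_eq_sum_range, Polynomial.eval_eq_sum_range,
      ← Finset.sum_add_distrib]
    refine Finset.sum_congr rfl fun j _ => ?_
    rw [Polynomial.eval_mul, Polynomial.eval_C, (h j x hx).1]; ring

end Kernel

section Localization

lemma Δn_pos {n : ℕ} (hn : 1 ≤ n) (x : ℝ) : 0 < Δn n x := by
  have : (0 : ℝ) < n := by exact_mod_cast hn
  unfold Δn; positivity

lemma one_sub_cosDiff_le_one_sub_cosSum {x y : ℝ} : 1 - cosDiff x y ≤ 1 - cosSum x y := by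
  linarith [cosSum_le_cosDiff x y]

lemma abs_sub_le_mul_Δn {n : ℕ} (hn : 1 ≤ n) {x y : ℝ} (hx : x ∈ Icc (-1 : ℝ) 1)
    (hy : y ∈ Icc (-1 : ℝ) 1) :
    |x - y| ≤ 2 * max ((n : ℝ) ^ 2 * (1 - cosDiff x y)) 1 * Δn n y := by
  have hn0 : (0 : ℝ) < n := by exact_mod_cast hn
  set m := max ((n : ℝ) ^ 2 * (1 - cosDiff x y)) 1 with hm
  have hm1 : 1 ≤ m := le_max_right _ _
  have hU : 1 - cosDiff x y ≤ m / n ^ 2 := by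
    rw [le_div_iff₀ (by positivity), mul_comm]; exact le_max_left _ _
  have hU0 : 0 ≤ 1 - cosDiff x y := by linarith [(cosDiff_mem hx hy).2]
  refine abs_le_of_sq_le_sq ?_ (by have := Δn_pos hn y; positivity)
  have e1 := one_sub_cosDiff hx hy
  have e2 := one_sub_cosSum hx hy
  rw [sq_sub_eq_mul hx hy]
  unfold Δn
  set a := √(1 - x ^ 2)
  set b := √(1 - y ^ 2)
  have hb : 0 ≤ b := Real.sqrt_nonneg _
  have hV : 1 - cosSum x y ≤ 2 * (1 - cosDiff x y) + 4 * b ^ 2 := by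
    nlinarith [sq_nonneg (a - 3 * b), sq_nonneg (x - y)]
  have hV2 : 1 - cosSum x y ≤ 2 * (m / n ^ 2) + 4 * b ^ 2 := by linarith
  calc (1 - cosDiff x y) * (1 - cosSum x y)
      ≤ (m / n ^ 2) * (2 * (m / n ^ 2) + 4 * b ^ 2) := by
        refine mul_le_mul hU hV2 ?_ (by positivity)
        linarith [(cosSum_mem hx hy).2]
    _ ≤ (m / n ^ 2) * (2 * (m / n ^ 2) + 4 * b ^ 2 * m) +
        m ^ 2 * (8 * b / n ^ 3 + 2 / n ^ 4) := by
        have h1 : 4 * b ^ 2 * 1 ≤ 4 * b ^ 2 * m := by gcongr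
        have h2 : 0 ≤ m ^ 2 * (8 * b / n ^ 3 + 2 / n ^ 4) := by positivity
        have h3 : (m / n ^ 2) * (2 * (m / n ^ 2) + 4 * b ^ 2) ≤
          (m / n ^ 2) * (2 * (m / n ^ 2) + 4 * b ^ 2 * m) :=
          mul_le_mul_of_nonneg_left (by linarith) (by positivity)
        linarith
    _ = (2 * m * (1 / ↑n * (b + 1 / ↑n))) ^ 2 := by field_simp; ring

lemma mul_one_sub_cosDiff_le_half {n : ℕ} (hn : 1 ≤ n) {x y : ℝ} (hx : x ∈ Icc (-1 : ℝ) 1)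
    (hy : y ∈ Icc (-1 : ℝ) 1) (h : |x - y| ≤ Δn n y / 4) :
    (n : ℝ) ^ 2 * (1 - cosDiff x y) ≤ 1 / 2 := by
  have hn0 : (0 : ℝ) < n := by exact_mod_cast hn
  by_contra! hcon
  have h1 : (x - y) ^ 2 ≤ (Δn n y / 4) ^ 2 := sq_le_sq' (by linarith [abs_le.1 h]) (abs_le.1 h).2
  have e1 := one_sub_cosDiff hx hy
  have e2 := one_sub_cosSum hx hy
  have e3 := one_sub_cosDiff_le_one_sub_cosSum (x := x) (y := y)
  have e4 : 0 ≤ (x - y) ^ 2 := sq_nonneg _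
  rw [sq_sub_eq_mul hx hy] at h1
  unfold Δn at h1
  set a := √(1 - x ^ 2)
  set b := √(1 - y ^ 2)
  have ha : 0 ≤ a := Real.sqrt_nonneg _
  have hb : 0 ≤ b := Real.sqrt_nonneg _
  set U := 1 - cosDiff x y
  set V := 1 - cosSum x y
  have hVb : b ^ 2 / 2 ≤ V := by rw [e2]; nlinarith [mul_nonneg ha hb, sq_nonneg a]
  have h2 : (n : ℝ) ^ 2 * V * (n ^ 2 * U) ≤ ((n * b) ^ 2 + 1) / 8 := by
    calc (n : ℝ) ^ 2 * V * (n ^ 2 * U) = n ^ 4 * (U * V) := by ring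
      _ ≤ n ^ 4 * (1 / ↑n * (b + 1 / ↑n) / 4) ^ 2 := by gcongr
      _ = (n * b + 1) ^ 2 / 16 := by field_simp; ring
      _ ≤ _ := by nlinarith [sq_nonneg (n * b - 1)]
  have h3 : ((n : ℝ) * b) ^ 2 / 2 ≤ n ^ 2 * V := by
    have := mul_le_mul_of_nonneg_left hVb (sq_nonneg (n : ℝ))
    linarith
  have h4 : (n : ℝ) ^ 2 * U ≤ n ^ 2 * V := by gcongr
  have h5 : (n : ℝ) ^ 2 * V * (1 / 2) < (n : ℝ) ^ 2 * V * (n ^ 2 * U) := by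
    refine mul_lt_mul_of_pos_left hcon (by linarith)
  linarith

lemma Δn_le_mul_Δn {n : ℕ} (hn : 1 ≤ n) {x y : ℝ} (hx : x ∈ Icc (-1 : ℝ) 1)
    (hy : y ∈ Icc (-1 : ℝ) 1) :
    Δn n x ≤ (2 + (n : ℝ) ^ 2 * (1 - cosDiff x y)) * Δn n y := by
  have hn0 : (0 : ℝ) < n := by exact_mod_cast hn
  have e1 := one_sub_cosDiff hx hy
  have hU0 : 0 ≤ 1 - cosDiff x y := by linarith [(cosDiff_mem hx hy).2]
  unfold Δn
  set a := √(1 - x ^ 2)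
  set b := √(1 - y ^ 2)
  have hb : 0 ≤ b := Real.sqrt_nonneg _
  set U := 1 - cosDiff x y
  have h1 : n * (a - b) ≤ 1 + n ^ 2 * U := by
    refine le_of_abs_le (abs_le_of_sq_le_sq ?_ (by positivity))
    have h2 : (a - b) ^ 2 ≤ 2 * U := by nlinarith [sq_nonneg (x - y)]
    have h3 := mul_le_mul_of_nonneg_left h2 (sq_nonneg (n : ℝ))
    nlinarith [sq_nonneg ((n : ℝ) ^ 2 * U)]
  have h2 : 0 ≤ (1 + n ^ 2 * U) * (n * b) := by positivity
  have h3 : n * a + 1 ≤ (2 + n ^ 2 * U) * (n * b + 1) := by nlinarith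
  calc 1 / (n : ℝ) * (a + 1 / n) = (n * a + 1) / n ^ 2 := by field_simp
    _ ≤ ((2 + n ^ 2 * U) * (n * b + 1)) / n ^ 2 := by gcongr
    _ = _ := by field_simp

/-- A polynomial of the cosine of the angle, decaying away from `1`, becomes after symmetrization
a polynomial concentrated near a point. -/
lemma exists_symmetrization_integral_le {n : ℕ} (hn : 1 ≤ n) {L : ℝ} (hL : 0 ≤ L) {k : ℕ}
    (hk : 2 * L ≤ 2 ^ k) {B : ℝ} (P : Polynomial ℝ)
    (h0 : ∀ c ∈ Icc (-1 : ℝ) 1, 0 ≤ P.eval c) (h1 : ∀ c ∈ Icc (-1 : ℝ) 1, P.eval c ≤ B)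
    (h2 : ∀ c ∈ Icc (-1 : ℝ) 1, P.eval c * ((n : ℝ) ^ 2 * (1 - c)) ^ k ≤ B)
    {y : ℝ} (hy : y ∈ Icc (-1 : ℝ) 1) :
    ∃ Q : Polynomial ℝ, Q.natDegree ≤ P.natDegree ∧ (∀ x ∈ Icc (-1 : ℝ) 1,
      Q.eval x = P.eval (cosDiff x y) + P.eval (cosSum x y)) ∧
      ∀ μ : Measure ℝ, IsFiniteMeasure μ → IsDoublingMeasure μ L →
        (∀ᵐ x ∂μ, x ∈ Icc (-1 : ℝ) 1) →
        ∫ x, Q.eval x ∂μ ≤ 2 ^ (k + 1) * (2 ^ (k + 1) * B) *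
          μ.real (Icc (y - Δn n y) (y + Δn n y)) := by
  obtain ⟨Q, hQd, hQ⟩ := exists_symmetrization P hy
  have hB : 0 ≤ B := (h0 1 (by simp)).trans (h1 1 (by simp))
  have hΔ := Δn_pos hn y
  refine ⟨Q, hQd, hQ, fun μ _ hd hs => hd.integral_le_of_decay hL hs hk Q.continuous hΔ hy
    (fun x hx => ?_) (fun x hx => ?_) (by positivity)⟩
  · rw [hQ x hx]
    have e1 := h1 _ (cosDiff_mem hx hy)
    have e2 := h1 _ (cosSum_mem hx hy)
    have e3 : (1 : ℝ) ≤ 2 ^ k := one_le_pow₀ one_le_two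
    have e4 : 1 * B ≤ 2 ^ k * B := by gcongr
    rw [pow_succ]; linarith
  · have hpt : ∀ c ∈ Icc (-1 : ℝ) 1, |x - y| ≤ 2 * max ((n : ℝ) ^ 2 * (1 - c)) 1 * Δn n y →
        P.eval c * |x - y| ^ k ≤ 2 ^ k * B * Δn n y ^ k := by
      intro c hc h
      have hm : P.eval c * max ((n : ℝ) ^ 2 * (1 - c)) 1 ^ k ≤ B := by
        rcases max_cases ((n : ℝ) ^ 2 * (1 - c)) 1 with ⟨e, -⟩ | ⟨e, -⟩
        · rw [e]; exact h2 c hc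
        · rw [e, one_pow, mul_one]; exact h1 c hc
      calc P.eval c * |x - y| ^ k
          ≤ P.eval c * (2 * max ((n : ℝ) ^ 2 * (1 - c)) 1 * Δn n y) ^ k := by
            have := h0 c hc
            gcongr
        _ = 2 ^ k * (P.eval c * max ((n : ℝ) ^ 2 * (1 - c)) 1 ^ k) * Δn n y ^ k := by
            rw [mul_pow, mul_pow]; ring
        _ ≤ _ := by gcongr
    have h3 := abs_sub_le_mul_Δn hn hx hy
    have e1 := hpt _ (cosDiff_mem hx hy) h3
    have e2 := hpt _ (cosSum_mem hx hy) (h3.trans (by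
      have := one_sub_cosDiff_le_one_sub_cosSum (x := x) (y := y)
      gcongr))
    rw [hQ x hx, add_mul, pow_succ]
    linarith

/-- Polynomials of degree `n` localized at scale `Δn n` near a point. -/
lemma exists_localized_polynomials {L : ℝ} (hL : 0 ≤ L) :
    ∃ C : ℝ, 1 ≤ C ∧ ∀ n : ℕ, 1 ≤ n → ∀ y ∈ Icc (-1 : ℝ) 1, ∃ p q : Polynomial ℝ,
      p.natDegree ≤ n ∧ q.natDegree ≤ n ∧ (∀ x ∈ Icc (-1 : ℝ) 1, 0 ≤ p.eval x) ∧
      (∀ x ∈ Icc (-1 : ℝ) 1, |x - y| ≤ Δn n y / 4 → 1 ≤ C * p.eval x) ∧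
      (∀ x ∈ Icc (-1 : ℝ) 1, ∀ T : ℝ, q.eval x < T * p.eval x →
        (n : ℝ) ^ 2 * (1 - cosDiff x y) < T) ∧
      ∀ μ : Measure ℝ, IsFiniteMeasure μ → IsDoublingMeasure μ L →
        (∀ᵐ x ∂μ, x ∈ Icc (-1 : ℝ) 1) →
        ∫ x, p.eval x ∂μ ≤ C * μ.real (Icc (y - Δn n y) (y + Δn n y)) ∧
        ∫ x, q.eval x ∂μ ≤ C * μ.real (Icc (y - Δn n y) (y + Δn n y)) := by
  obtain ⟨k, hk⟩ := pow_unbounded_of_one_lt (2 * L) (one_lt_two (α := ℝ))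
  obtain ⟨B, hB, hP⟩ := exists_jackson_kernel (k + 1) (by omega)
  have hD1 : (1 : ℝ) ≤ 2 ^ (k + 1) := one_le_pow₀ one_le_two
  have hD2 : (1 : ℝ) ≤ 4 ^ (k + 1) := one_le_pow₀ (by norm_num)
  set D : ℝ := 2 ^ (k + 1) * (2 ^ (k + 1) * B) with hD
  have hD3 : 1 ≤ D := one_le_mul_of_one_le_of_one_le hD1 (one_le_mul_of_one_le_of_one_le hD1 hB)
  have hCD : D ≤ D * 4 ^ (k + 1) := le_mul_of_one_le_right (by linarith) hD2
  have hC4 : 4 ^ (k + 1) ≤ D * 4 ^ (k + 1) := le_mul_of_one_le_left (by linarith) hD3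
  refine ⟨D * 4 ^ (k + 1), hD3.trans hCD, fun n hn y hy => ?_⟩
  obtain ⟨P, hPd, hPe⟩ := hP n hn
  have hτ : ∀ c ∈ Icc (-1 : ℝ) 1, 0 ≤ (n : ℝ) ^ 2 * (1 - c) := fun c hc =>
    mul_nonneg (sq_nonneg _) (by linarith [hc.2])
  have hlow : ∀ j ≤ k + 1, ∀ c ∈ Icc (-1 : ℝ) 1, P.eval c * ((n : ℝ) ^ 2 * (1 - c)) ^ j ≤ B := by
    intro j hj c hc
    obtain ⟨e0, e1, e2, -⟩ := hPe c hc
    rcases le_total ((n : ℝ) ^ 2 * (1 - c)) 1 with h | h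
    · have : P.eval c * ((n : ℝ) ^ 2 * (1 - c)) ^ j ≤ 1 * 1 := by
        refine mul_le_mul e1 (pow_le_one₀ (hτ c hc) h) (pow_nonneg (hτ c hc) _) zero_le_one
      linarith
    · refine le_trans ?_ e2
      gcongr
  set P₂ : Polynomial ℝ := Polynomial.C ((n : ℝ) ^ 2) * (1 - Polynomial.X) * P with hP₂
  have hP₂e : ∀ c, P₂.eval c = P.eval c * ((n : ℝ) ^ 2 * (1 - c)) := fun c => by
    simp [hP₂]; ring
  have hP₂d : P₂.natDegree ≤ n := by
    refine Polynomial.natDegree_mul_le.trans ?_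
    have : (Polynomial.C ((n : ℝ) ^ 2) * (1 - Polynomial.X)).natDegree ≤ 1 := by compute_degree
    omega
  obtain ⟨p, hpd, hpe, hpi⟩ := exists_symmetrization_integral_le hn hL hk.le P
    (fun c hc => (hPe c hc).1) (fun c hc => by simpa using hlow 0 (by omega) c hc)
    (fun c hc => hlow k (by omega) c hc) hy
  obtain ⟨q, hqd, hqe, hqi⟩ := exists_symmetrization_integral_le hn hL hk.le P₂
    (fun c hc => by rw [hP₂e]; exact mul_nonneg (hPe c hc).1 (hτ c hc))
    (fun c hc => by rw [hP₂e]; simpa using hlow 1 (by omega) c hc)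
    (fun c hc => by
      rw [hP₂e, mul_assoc, ← pow_succ']; exact hlow (k + 1) le_rfl c hc) hy
  refine ⟨p, q, by omega, by omega, fun x hx => ?_, fun x hx h => ?_, fun x hx T h => ?_,
    fun μ hμ hd hs => ⟨(hpi μ hμ hd hs).trans (by gcongr), (hqi μ hμ hd hs).trans (by gcongr)⟩⟩
  · rw [hpe x hx]
    exact add_nonneg (hPe _ (cosDiff_mem hx hy)).1 (hPe _ (cosSum_mem hx hy)).1
  · rw [hpe x hx]
    have e1 := (hPe _ (cosDiff_mem hx hy)).2.2.2 (mul_one_sub_cosDiff_le_half hn hx hy h)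
    have e2 := (hPe _ (cosSum_mem hx hy)).1
    calc (1 : ℝ) = 4 ^ (k + 1) * (1 / 4) ^ (k + 1) := by rw [← mul_pow]; norm_num
      _ ≤ D * 4 ^ (k + 1) * (P.eval (cosDiff x y) + P.eval (cosSum x y)) := by
        refine mul_le_mul hC4 (by linarith) (by positivity) (by positivity)
  · by_contra! hcon
    rw [hqe x hx, hpe x hx, hP₂e, hP₂e] at h
    have e1 := (hPe _ (cosDiff_mem hx hy)).1
    have e2 := (hPe _ (cosSum_mem hx hy)).1
    have e3 : T ≤ (n : ℝ) ^ 2 * (1 - cosSum x y) := hcon.trans (by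
      have := one_sub_cosDiff_le_one_sub_cosSum (x := x) (y := y)
      gcongr)
    nlinarith [mul_le_mul_of_nonneg_left hcon e1, mul_le_mul_of_nonneg_left e3 e2]

/-- The nodes of an equal weight quadrature formula carry at most as much mass as the
measure does at scale `Δn n`. -/
lemma exists_total_le_of_quadrature {L : ℝ} (hL : 1 ≤ L) :
    ∃ C : ℝ, 0 < C ∧ ∀ μ : Measure ℝ, IsFiniteMeasure μ → IsDoublingMeasure μ L →
      (∀ᵐ x ∂μ, x ∈ Icc (-1 : ℝ) 1) → ∀ n : ℕ, 1 ≤ n → ∀ (N : ℕ) (t : Fin N → ℝ),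
      (∀ i, t i ∈ Icc (-1 : ℝ) 1) → (∀ p : Polynomial ℝ, p.natDegree ≤ n →
        ∫ x, p.eval x ∂μ = μ.real univ / N * ∑ i, p.eval (t i)) →
      ∀ y ∈ Icc (-1 : ℝ) 1,
        μ.real univ ≤ N * (C * μ.real (Icc (y - Δn n y) (y + Δn n y))) := by
  have hL0 : 0 ≤ L := by linarith
  obtain ⟨C, hC, hpq⟩ := exists_localized_polynomials hL0
  set T : ℝ := C * C * L ^ 2 with hT
  have hT1 : 1 ≤ T := one_le_mul_of_one_le_of_one_le (one_le_mul_of_one_le_of_one_le hC hC)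
    (one_le_pow₀ hL)
  obtain ⟨m, hm⟩ := pow_unbounded_of_one_lt (8 * T) (one_lt_two (α := ℝ))
  refine ⟨C * C * L ^ m, by positivity, fun μ hμ hd hs n hn N t ht hq y hy => ?_⟩
  rcases (measureReal_nonneg (μ := μ) (s := univ)).eq_or_lt' with hW | hW
  · rw [hW]; positivity
  have hN : (0 : ℝ) < N := by
    rcases Nat.eq_zero_or_pos N with rfl | h
    · have := hq 1 (by simp)
      simp at this
      rw [this] at hW
      simp at hW
    · exact_mod_cast h
  have hΔ := Δn_pos hn y
  obtain ⟨p, q, hpd, hqd, hp0, hp1, hT', hi⟩ := hpq n hn y hy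
  obtain ⟨hip, hiq⟩ := hi μ hμ hd hs
  have hpi : Integrable (fun x => p.eval x) μ := integrable_of_continuous_of_ae_mem hs p.continuous
  set M := μ.real (Icc (y - Δn n y) (y + Δn n y)) with hM
  have hMpos : 0 < M := hd.pos hL0 hs hW hΔ hy
  have hlow : M ≤ C * L ^ 2 * ∫ x, p.eval x ∂μ := by
    have h1 := hd.two_pow hL0 2 (δ := Δn n y / 4) (by positivity) hy
    have h2 : (2 : ℝ) ^ 2 * (Δn n y / 4) = Δn n y := by ring
    rw [h2] at h1
    have h3 : μ.real (Icc (y - Δn n y / 4) (y + Δn n y / 4)) ≤ C * ∫ x, p.eval x ∂μ := by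
      rw [← integral_indicator_one measurableSet_Icc, ← integral_const_mul]
      refine integral_mono_ae ?_ (hpi.const_mul C) ?_
      · exact (integrable_const (1 : ℝ)).indicator measurableSet_Icc
      · filter_upwards [hs] with x hx
        by_cases hxm : x ∈ Icc (y - Δn n y / 4) (y + Δn n y / 4)
        · rw [indicator_of_mem hxm]
          exact hp1 x hx (abs_le.2 ⟨by linarith [hxm.1], by linarith [hxm.2]⟩)
        · rw [indicator_of_notMem hxm]
          exact mul_nonneg (by linarith) (hp0 x hx)
    calc M ≤ _ := h1
      _ ≤ L ^ 2 * (C * ∫ x, p.eval x ∂μ) := by gcongr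
      _ = _ := by ring
  have hWN : 0 < μ.real univ / N := div_pos hW hN
  have hS : ∑ i, q.eval (t i) ≤ T * ∑ i, p.eval (t i) := by
    have h1 : ∫ x, q.eval x ∂μ ≤ T * ∫ x, p.eval x ∂μ := by
      calc _ ≤ C * M := hiq
        _ ≤ C * (C * L ^ 2 * ∫ x, p.eval x ∂μ) := by gcongr
        _ = _ := by rw [hT]; ring
    rw [hq q hqd, hq p hpd, mul_left_comm] at h1
    exact le_of_mul_le_mul_left h1 hWN
  have hSp : 0 < ∑ i, p.eval (t i) := by
    have h1 : 0 < C * L ^ 2 * ∫ x, p.eval x ∂μ := hMpos.trans_le hlow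
    have h2 : 0 < ∫ x, p.eval x ∂μ := pos_of_mul_pos_right h1 (by positivity)
    rw [hq p hpd] at h2
    exact pos_of_mul_pos_right h2 hWN.le
  obtain ⟨i, hi'⟩ : ∃ i, q.eval (t i) < 2 * T * p.eval (t i) := by
    by_contra! hcon
    have h1 := Finset.sum_le_sum fun i (_ : i ∈ Finset.univ) => hcon i
    rw [← Finset.mul_sum] at h1
    nlinarith
  have hτ := hT' _ (ht i) _ hi'
  have hdist : |t i - y| ≤ 4 * T * Δn n y := by
    refine (abs_sub_le_mul_Δn hn (ht i) hy).trans ?_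
    have : max ((n : ℝ) ^ 2 * (1 - cosDiff (t i) y)) 1 ≤ 2 * T := max_le hτ.le (by linarith)
    calc _ ≤ 2 * (2 * T) * Δn n y := by gcongr
      _ = _ := by ring
  have hΔt : Δn n (t i) ≤ 4 * T * Δn n y := by
    refine (Δn_le_mul_Δn hn (ht i) hy).trans ?_
    gcongr
    linarith
  obtain ⟨p', q', hpd', -, hp0', hp1', -, hi2⟩ := hpq n hn (t i) (ht i)
  have hip' := (hi2 μ hμ hd hs).1
  have hball : μ.real (Icc (t i - Δn n (t i)) (t i + Δn n (t i))) ≤ L ^ m * M := by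
    refine hd.le_of_subset hL0 m hΔ hy ?_
    nlinarith
  have hone : 1 ≤ C * ∑ j, p'.eval (t j) := by
    refine (hp1' (t i) (ht i) (by have := Δn_pos hn (t i); simp; positivity)).trans ?_
    gcongr
    exact Finset.single_le_sum (f := fun j => p'.eval (t j)) (fun j _ => hp0' _ (ht j))
      (Finset.mem_univ i)
  rw [hq p' hpd'] at hip'
  calc μ.real univ = N * (μ.real univ / N * 1) := by field_simp
    _ ≤ N * (μ.real univ / N * (C * ∑ j, p'.eval (t j))) := by gcongr
    _ = N * (C * (μ.real univ / N * ∑ j, p'.eval (t j))) := by ring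
    _ ≤ N * (C * (C * (L ^ m * M))) := by
      have h1 := hip'.trans (mul_le_mul_of_nonneg_left hball (by linarith : (0 : ℝ) ≤ C))
      exact mul_le_mul_of_nonneg_left (mul_le_mul_of_nonneg_left h1 (by linarith)) hN.le
    _ = _ := by ring

end Localization

section Variation

/-- The image under `cos` of an interval of length `2 * δ` contains a ball comparable to
`Δn n`. -/
lemma Δn_cos_mul_cos_le {n : ℕ} (hn : 1 ≤ n) {γ δ K : ℝ} (hK : 0 < K) (hδ : δ = π / (2 * K * n))
    (h1 : δ ≤ γ) (h2 : γ ≤ π - δ) :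
    0 < sin γ * sin δ ∧ Δn n (cos γ * cos δ) ≤ K * (K + 2) * (sin γ * sin δ) := by
  have hn0 : (0 : ℝ) < n := by exact_mod_cast hn
  have hδ0 : 0 < δ := by rw [hδ]; positivity
  have hsδ : 1 / n ≤ K * sin δ := by
    have h3 := Real.mul_le_sin hδ0.le (by linarith)
    calc (1 : ℝ) / n = K * (2 / π * δ) := by rw [hδ]; field_simp
      _ ≤ K * sin δ := by gcongr
  have hsδ0 : 0 < sin δ := sin_pos_of_pos_of_lt_pi hδ0 (by linarith)
  have hsγ : sin δ ≤ sin γ := by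
    have h3 := Real.sin_sub_sin γ δ
    have h4 : 0 ≤ sin ((γ - δ) / 2) := sin_nonneg_of_nonneg_of_le_pi (by linarith) (by linarith)
    have h5 : 0 ≤ cos ((γ + δ) / 2) := cos_nonneg_of_neg_pi_div_two_le_of_le (by linarith)
      (by linarith)
    nlinarith [mul_nonneg h4 h5]
  have hsγ0 : 0 < sin γ := hsδ0.trans_le hsγ
  refine ⟨by positivity, ?_⟩
  have h3 : √(1 - (cos γ * cos δ) ^ 2) ≤ 2 * sin γ := by
    rw [Real.sqrt_le_left (by positivity)]
    have e1 := sin_sq_add_cos_sq γ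
    have e2 := sin_sq_add_cos_sq δ
    have e3 : 1 - (cos γ * cos δ) ^ 2 = sin γ ^ 2 + cos γ ^ 2 * sin δ ^ 2 := by
      linear_combination (-cos γ ^ 2) * e2 - e1
    have e4 : cos γ ^ 2 * sin δ ^ 2 ≤ 1 * sin γ ^ 2 := by
      gcongr
      nlinarith [sq_nonneg (sin γ)]
    nlinarith [sq_nonneg (sin γ)]
  unfold Δn
  calc 1 / (n : ℝ) * (√(1 - (cos γ * cos δ) ^ 2) + 1 / n)
      ≤ K * sin δ * (2 * sin γ + K * sin δ) := by gcongr
    _ ≤ K * sin δ * (2 * sin γ + K * sin γ) := by gcongr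
    _ = _ := by ring

lemma integral_abs_derivative_eq (g : Polynomial ℝ) :
    ∫ x in (-1 : ℝ)..1, |g.derivative.eval x| =
      ∫ θ in (0 : ℝ)..π, |g.derivative.eval (cos θ) * sin θ| := by
  have h := intervalIntegral.integral_comp_mul_deriv (a := 0) (b := π) (f := cos)
    (f' := fun θ => -sin θ) (g := fun x => |g.derivative.eval x|)
    (fun x _ => hasDerivAt_cos x) (by fun_prop) (by fun_prop)
  rw [cos_zero, cos_pi] at h
  rw [intervalIntegral.integral_symm, ← h, ← intervalIntegral.integral_neg]
  refine intervalIntegral.integral_congr fun θ hθ => ?_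
  rw [uIcc_of_le pi_pos.le] at hθ
  simp only [Function.comp, mul_neg, neg_neg]
  rw [abs_mul, abs_of_nonneg (sin_nonneg_of_nonneg_of_le_pi hθ.1 hθ.2)]

lemma abs_eval_cos_le_add_integral (g : Polynomial ℝ) {α β s φ : ℝ} (hs : s ∈ Icc α β)
    (hφ : φ ∈ Icc α β) :
    |g.eval (cos s)| ≤ |g.eval (cos φ)| +
      ∫ θ in α..β, |g.derivative.eval (cos θ) * sin θ| := by
  have hd : ∀ θ, HasDerivAt (fun θ => g.eval (cos θ)) (-(g.derivative.eval (cos θ) * sin θ)) θ := by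
    intro θ
    have := (g.hasDerivAt (cos θ)).comp θ (hasDerivAt_cos θ)
    rw [mul_neg] at this
    exact this
  have h1 : ∫ θ in φ..s, -(g.derivative.eval (cos θ) * sin θ) =
      g.eval (cos s) - g.eval (cos φ) :=
    intervalIntegral.integral_eq_sub_of_hasDerivAt (fun θ _ => hd θ)
      (Continuous.intervalIntegrable (by fun_prop) _ _)
  have h2 : |g.eval (cos s) - g.eval (cos φ)| ≤
      |(∫ θ in φ..s, |g.derivative.eval (cos θ) * sin θ|)| := by
    rw [← h1]
    have h := intervalIntegral.norm_integral_le_abs_integral_norm (a := φ) (b := s) (μ := volume)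
      (f := fun θ => -(g.derivative.eval (cos θ) * sin θ))
    simpa only [Real.norm_eq_abs, abs_neg] using h
  have h3 : |(∫ θ in φ..s, |g.derivative.eval (cos θ) * sin θ|)| ≤
      |(∫ θ in α..β, |g.derivative.eval (cos θ) * sin θ|)| := by
    refine intervalIntegral.abs_integral_mono_interval ?_ ?_ ?_
    · rw [uIoc_of_le (hs.1.trans hs.2)]
      exact Ioc_subset_Ioc (le_min hφ.1 hs.1) (max_le hφ.2 hs.2)
    · exact Filter.Eventually.of_forall fun _ => abs_nonneg _
    · exact Continuous.intervalIntegrable (by fun_prop) _ _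
  rw [abs_of_nonneg (a := ∫ θ in α..β, _)
    (intervalIntegral.integral_nonneg (hs.1.trans hs.2) fun _ _ => abs_nonneg _)] at h3
  have h4 := abs_add_le (g.eval (cos s) - g.eval (cos φ)) (g.eval (cos φ))
  rw [sub_add_cancel] at h4
  linarith

lemma integral_abs_eval_cos_cell_le {μ : Measure ℝ} [IsFiniteMeasure μ] [NullSingletonClass μ]
    (g : Polynomial ℝ) {α β m : ℝ} (hα : 0 ≤ α) (hαβ : α ≤ β) (hβ : β ≤ π) (hm : 0 < m)
    (hμ : m ≤ μ.real (Icc (cos β) (cos α))) :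
    ∫ θ in α..β, |g.eval (cos θ)| ≤
      (β - α) * (∫ θ in α..β, |g.derivative.eval (cos θ) * sin θ|) +
      (β - α) / m * ∫ x in (cos β)..(cos α), |g.eval x| ∂μ := by
  have hcos : cos β ≤ cos α := cos_le_cos_of_nonneg_of_le_pi hα hβ hαβ
  set V := ∫ θ in α..β, |g.derivative.eval (cos θ) * sin θ| with hV
  set G := ∫ x in (cos β)..(cos α), |g.eval x| ∂μ with hG
  have hgi : IntegrableOn (fun x => |g.eval x|) (Icc (cos β) (cos α)) μ :=
    (show Continuous fun x => |g.eval x| by fun_prop).continuousOn.integrableOn_Icc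
  have hpt : ∀ s ∈ Icc α β, |g.eval (cos s)| ≤ V + G / m := by
    intro s hs
    have hG0 : 0 ≤ G := intervalIntegral.integral_nonneg_of_forall hcos fun _ => abs_nonneg _
    by_cases hle : |g.eval (cos s)| - V ≤ 0
    · have : 0 ≤ G / m := by positivity
      linarith
    push Not at hle
    have h1 : (|g.eval (cos s)| - V) * μ.real (Icc (cos β) (cos α)) ≤ G := by
      rw [hG, intervalIntegral.integral_of_le hcos, ← integral_Icc_eq_integral_Ioc]
      have h2 : ∫ x in Icc (cos β) (cos α), (|g.eval (cos s)| - V) ∂μ ≤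
          ∫ x in Icc (cos β) (cos α), |g.eval x| ∂μ := by
        refine setIntegral_mono_on (integrable_const _) hgi measurableSet_Icc fun y hy => ?_
        have hy1 : -1 ≤ y := (neg_one_le_cos _).trans hy.1
        have hy2 : y ≤ 1 := hy.2.trans (cos_le_one _)
        have h3 := abs_eval_cos_le_add_integral g hs (φ := arccos y) ⟨?_, ?_⟩
        · rw [cos_arccos hy1 hy2] at h3; linarith
        · rw [← arccos_cos hα (hαβ.trans hβ)]; exact arccos_le_arccos hy.2
        · rw [← arccos_cos (hα.trans hαβ) hβ]; exact arccos_le_arccos hy.1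
      rw [setIntegral_const, smul_eq_mul, mul_comm] at h2
      exact h2
    have h4 : |g.eval (cos s)| - V ≤ G / m := by
      rw [le_div_iff₀ hm]
      exact (mul_le_mul_of_nonneg_left hμ hle.le).trans h1
    linarith
  calc ∫ θ in α..β, |g.eval (cos θ)| ≤ ∫ θ in α..β, (V + G / m) :=
        intervalIntegral.integral_mono_on hαβ
          (Continuous.intervalIntegrable (by fun_prop) _ _) (by simp) hpt
    _ = _ := by rw [intervalIntegral.integral_const, smul_eq_mul]; ring

/-- The total variation of a polynomial of degree `n` is controlled by its `L¹` norm with respect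
to a doubling measure. -/
lemma integral_abs_derivative_le {L : ℝ} (hL : 1 ≤ L) {μ : Measure ℝ} [IsFiniteMeasure μ]
    [NullSingletonClass μ] (hd : IsDoublingMeasure μ L) (hs : ∀ᵐ x ∂μ, x ∈ Icc (-1 : ℝ) 1) {n : ℕ}
    (hn : 1 ≤ n) {M : ℝ} (hM : 0 < M)
    (hμ : ∀ x ∈ Icc (-1 : ℝ) 1, M ≤ μ.real (Icc (x - Δn n x) (x + Δn n x)))
    (g : Polynomial ℝ) (hg : g.natDegree ≤ n) :
    M * ∫ x in (-1 : ℝ)..1, |g.derivative.eval x| ≤ L ^ 8 * ∫ x, |g.eval x| ∂μ := by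
  have hn0 : (0 : ℝ) < n := by exact_mod_cast hn
  have hL0 : 0 < L := by linarith
  rw [integral_abs_derivative_eq]
  have hB := integral_abs_deriv_cos_le n hn g hg
  set V := ∫ θ in (0 : ℝ)..π, |g.derivative.eval (cos θ) * sin θ| with hV
  set A := ∫ θ in (0 : ℝ)..π, |g.eval (cos θ)| with hA
  set G := ∫ x, |g.eval x| ∂μ with hG
  set h : ℝ := π / (13 * n) with hh
  have hh0 : 0 < h := by positivity
  have hnh : 13 * n * h = π := by rw [hh]; field_simp
  set m : ℝ := M / L ^ 8 with hm
  have hm0 : 0 < m := by positivity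
  let θ : ℕ → ℝ := fun j => j * h
  have hθ0 : θ 0 = 0 := by simp [θ]
  have hθn : θ (13 * n) = π := by simp only [θ]; push_cast; exact hnh
  have hθs : ∀ j, θ (j + 1) - θ j = h := fun j => by simp only [θ]; push_cast; ring
  have hcell : ∀ j ∈ Finset.range (13 * n), ∫ s in θ j..θ (j + 1), |g.eval (cos s)| ≤
      h * (∫ s in θ j..θ (j + 1), |g.derivative.eval (cos s) * sin s|) +
      h / m * ∫ x in cos (θ (j + 1))..cos (θ j), |g.eval x| ∂μ := by
    intro j hj
    have hj' : ((j : ℝ) + 1) ≤ 13 * n := by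
      have := Finset.mem_range.1 hj
      exact_mod_cast this
    have h0 : 0 ≤ θ j := by positivity
    have h1 : θ (j + 1) ≤ π := by
      rw [← hnh]; simp only [θ]; push_cast; gcongr
    have hstep := hθs j
    obtain ⟨hr, hΔ⟩ := Δn_cos_mul_cos_le hn (γ := θ j + h / 2) (δ := h / 2) (K := 13)
      (by norm_num) (by rw [hh]; field_simp) (by linarith) (by linarith)
    set γ := θ j + h / 2 with hγ
    set r := sin γ * sin (h / 2) with hrr
    set c := cos γ * cos (h / 2) with hc
    have hca : cos (θ j) = c + r := by
      rw [show θ j = γ - h / 2 by rw [hγ]; ring, cos_sub]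
    have hcb : cos (θ (j + 1)) = c - r := by
      rw [show θ (j + 1) = γ + h / 2 by rw [hγ]; linarith, cos_add]
    have hcm : c ∈ Icc (-1 : ℝ) 1 := by
      have e1 := neg_one_le_cos (θ (j + 1))
      have e2 := cos_le_one (θ j)
      constructor <;> linarith
    have key := integral_abs_eval_cos_cell_le (μ := μ) g h0 (by linarith) h1 hm0 (by
      rw [hca, hcb, hm, div_le_iff₀ (by positivity), mul_comm]
      refine (hμ c hcm).trans (hd.le_of_subset hL0.le 8 hr hcm ?_)
      rw [sub_self, abs_zero, zero_add]
      refine hΔ.trans ?_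
      nlinarith)
    rw [hstep] at key
    exact key
  have hsum := Finset.sum_le_sum hcell
  rw [Finset.sum_add_distrib, ← Finset.mul_sum, ← Finset.mul_sum] at hsum
  have s1 := intervalIntegral.sum_integral_adjacent_intervals (a := θ) (n := 13 * n)
    (f := fun s => |g.eval (cos s)|) (μ := volume)
    (fun k _ => Continuous.intervalIntegrable (by fun_prop) _ _)
  have s2 := intervalIntegral.sum_integral_adjacent_intervals (a := θ) (n := 13 * n)
    (f := fun s => |g.derivative.eval (cos s) * sin s|) (μ := volume)
    (fun k _ => Continuous.intervalIntegrable (by fun_prop) _ _)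
  have s3 := intervalIntegral.sum_integral_adjacent_intervals (a := fun j => cos (θ j))
    (n := 13 * n) (f := fun x => |g.eval x|) (μ := μ)
    (fun k _ => Continuous.intervalIntegrable (by fun_prop) _ _)
  rw [hθ0, hθn] at s1 s2 s3
  rw [s1, s2] at hsum
  have s4 : ∑ j ∈ Finset.range (13 * n), ∫ x in cos (θ (j + 1))..cos (θ j), |g.eval x| ∂μ ≤ G := by
    simp_rw [fun j => intervalIntegral.integral_symm (μ := μ) (f := fun x => |g.eval x|)
      (cos (θ j)) (cos (θ (j + 1)))]
    rw [Finset.sum_neg_distrib, s3, ← intervalIntegral.integral_symm, cos_zero, cos_pi,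
      intervalIntegral.integral_of_le (by norm_num)]
    exact setIntegral_le_integral (integrable_of_continuous_of_ae_mem hs (by fun_prop))
      (Filter.Eventually.of_forall fun _ => abs_nonneg _)
  have s5 : A ≤ h * V + h / m * G := hsum.trans (by gcongr)
  have hpi : 2 * n * h ≤ 1 / 2 := by nlinarith [pi_lt_d2]
  have hA0 : 0 ≤ A := intervalIntegral.integral_nonneg pi_pos.le fun _ _ => abs_nonneg _
  have hG0 : 0 ≤ G / m := div_nonneg (integral_nonneg fun _ => abs_nonneg _) hm0.le
  have s6 : h * V ≤ A / 2 := by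
    calc h * V ≤ h * (2 * n * A) := by gcongr
      _ = (2 * n * h) * A := by ring
      _ ≤ 1 / 2 * A := by gcongr
      _ = _ := by ring
  have s7 : A ≤ 2 * h * (G / m) := by
    have : h / m * G = h * (G / m) := by ring
    linarith
  have s8 : V ≤ G / m := by
    calc V ≤ 2 * n * A := hB
      _ ≤ 2 * n * (2 * h * (G / m)) := by gcongr
      _ = 2 * (2 * n * h) * (G / m) := by ring
      _ ≤ 2 * (1 / 2) * (G / m) := by gcongr
      _ = _ := by ring
  rw [hm] at s8
  calc M * V ≤ M * (G / (M / L ^ 8)) := by gcongr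
    _ = _ := by field_simp

end Variation

section Existence

lemma exists_continuous_root {X : Type*} [TopologicalSpace X] (Φ : X → ℝ → ℝ)
    (hΦ : ∀ x ∈ Icc (-1 : ℝ) 1, Continuous fun a => Φ a x)
    (hmono : ∀ a, StrictMonoOn (Φ a) (Icc (-1) 1)) (hcont : ∀ a, ContinuousOn (Φ a) (Icc (-1) 1))
    (h0 : ∀ a, Φ a (-1) ≤ 0) (h1 : ∀ a, 0 ≤ Φ a 1) :
    ∃ q : X → ℝ, Continuous q ∧ ∀ a, q a ∈ Icc (-1 : ℝ) 1 ∧ Φ a (q a) = 0 := by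
  have hex : ∀ a, ∃ x ∈ Icc (-1 : ℝ) 1, Φ a x = 0 := fun a =>
    intermediate_value_Icc (by norm_num) (hcont a) ⟨h0 a, h1 a⟩
  choose q hq hq0 using hex
  refine ⟨q, continuous_iff_continuousAt.2 fun a₀ => tendsto_order.2 ⟨fun x hx => ?_,
    fun x hx => ?_⟩, fun a => ⟨hq a, hq0 a⟩⟩
  · by_cases hx1 : x < -1
    · exact Filter.Eventually.of_forall fun a => hx1.trans_le (hq a).1
    have hxm : x ∈ Icc (-1 : ℝ) 1 := ⟨not_lt.1 hx1, hx.le.trans (hq a₀).2⟩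
    have h2 : Φ a₀ x < 0 := hq0 a₀ ▸ hmono a₀ hxm (hq a₀) hx
    filter_upwards [(hΦ x hxm).continuousAt.eventually_lt continuousAt_const h2] with a ha
    rw [← hq0 a] at ha
    exact ((hmono a).lt_iff_lt hxm (hq a)).1 ha
  · by_cases hx1 : 1 < x
    · exact Filter.Eventually.of_forall fun a => (hq a).2.trans_lt hx1
    have hxm : x ∈ Icc (-1 : ℝ) 1 := ⟨(hq a₀).1.trans hx.le, not_lt.1 hx1⟩
    have h2 : 0 < Φ a₀ x := hq0 a₀ ▸ hmono a₀ (hq a₀) hxm hx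
    filter_upwards [continuousAt_const.eventually_lt (hΦ x hxm).continuousAt h2] with a ha
    rw [← hq0 a] at ha
    exact ((hmono a).lt_iff_lt (hq a) hxm).1 ha

variable {μ : Measure ℝ}

lemma integral_eq_intervalIntegral_of_ae_mem [NullSingletonClass μ]
    (hs : ∀ᵐ x ∂μ, x ∈ Icc (-1 : ℝ) 1) (f : ℝ → ℝ) :
    ∫ x, f x ∂μ = ∫ x in (-1 : ℝ)..1, f x ∂μ := by
  rw [intervalIntegral.integral_of_le (by norm_num), ← integral_Icc_eq_integral_Ioc,
    Measure.restrict_eq_self_of_ae_mem hs]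

lemma strictMonoOn_intervalIntegral [IsFiniteMeasure μ]
    (hpos : ∀ x ∈ Icc (-1 : ℝ) 1, ∀ y ∈ Icc (-1 : ℝ) 1, x < y → 0 < μ (Ioc x y)) {f : ℝ → ℝ}
    (hf : Continuous f) (hf0 : ∀ x, 0 < f x) :
    StrictMonoOn (fun x => ∫ t in (-1 : ℝ)..x, f t ∂μ) (Icc (-1) 1) := by
  intro x hx y hy hxy
  have hi : ∀ a b, IntervalIntegrable f μ a b := fun a b => hf.intervalIntegrable a b
  have h1 := intervalIntegral.integral_add_adjacent_intervals (hi (-1) x) (hi x y)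
  have h2 : 0 < ∫ t in x..y, f t ∂μ := by
    rw [intervalIntegral.integral_pos_iff_support_of_nonneg_ae
      (Filter.Eventually.of_forall fun t => (hf0 t).le) (hi x y)]
    refine ⟨hxy, ?_⟩
    have : Function.support f = univ := by ext t; simp [(hf0 t).ne']
    rw [this, univ_inter]
    exact hpos x hx y hy hxy
  simp only
  linarith

lemma exists_continuous_quantile {X : Type*} [TopologicalSpace X] [FirstCountableTopology X]
    [LocallyCompactSpace X] [IsFiniteMeasure μ] [NullSingletonClass μ]
    (hpos : ∀ x ∈ Icc (-1 : ℝ) 1, ∀ y ∈ Icc (-1 : ℝ) 1, x < y → 0 < μ (Ioc x y))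
    (f : X → ℝ → ℝ) (hf : Continuous (Function.uncurry f)) (hf0 : ∀ a t, 0 < f a t) {s : ℝ}
    (hs : s ∈ Icc (0 : ℝ) 1) :
    ∃ q : X → ℝ, Continuous q ∧ ∀ a, q a ∈ Icc (-1 : ℝ) 1 ∧
      ∫ t in (-1 : ℝ)..q a, f a t ∂μ = s * ∫ t in (-1 : ℝ)..1, f a t ∂μ := by
  have hfc : ∀ a, Continuous (f a) := fun a =>
    hf.comp (Continuous.prodMk_right a)
  have hpar : ∀ x, Continuous fun a => ∫ t in (-1 : ℝ)..x, f a t ∂μ := fun x =>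
    intervalIntegral.continuous_parametric_intervalIntegral_of_continuous' hf _ _
  have hZ : ∀ a, 0 ≤ ∫ t in (-1 : ℝ)..1, f a t ∂μ := fun a =>
    intervalIntegral.integral_nonneg (by norm_num) fun t _ => (hf0 a t).le
  obtain ⟨q, hq, h⟩ := exists_continuous_root
    (fun a x => ∫ t in (-1 : ℝ)..x, f a t ∂μ - s * ∫ t in (-1 : ℝ)..1, f a t ∂μ)
    (fun x _ => (hpar x).sub ((hpar 1).const_mul s))
    (fun a x hx y hy hxy => sub_lt_sub_right
      (strictMonoOn_intervalIntegral hpos (hfc a) (hf0 a) hx hy hxy) _)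
    (fun a => (Continuous.continuousOn <|
      (intervalIntegral.continuous_primitive (fun _ _ => (hfc a).intervalIntegrable _ _) _).sub
        continuous_const))
    (fun a => by simp only [intervalIntegral.integral_same]; nlinarith [hZ a, hs.1])
    (fun a => by nlinarith [hZ a, hs.2])
  exact ⟨q, hq, fun a => ⟨(h a).1, sub_eq_zero.1 (h a).2⟩⟩

lemma eval_le_add_integral (g : Polynomial ℝ) {u v t : ℝ} (ht : t ∈ Icc u v) :
    g.eval t ≤ g.eval v + ∫ x in u..v, |g.derivative.eval x| := by
  have h1 : ∫ x in t..v, g.derivative.eval x = g.eval v - g.eval t :=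
    intervalIntegral.integral_eq_sub_of_hasDerivAt (fun x _ => g.hasDerivAt x)
      (Continuous.intervalIntegrable (by fun_prop) _ _)
  have h2 := intervalIntegral.abs_integral_le_integral_abs (f := fun x => g.derivative.eval x)
    (μ := volume) ht.2
  have h3 : ∫ x in t..v, |g.derivative.eval x| ≤ ∫ x in u..v, |g.derivative.eval x| :=
    intervalIntegral.integral_mono_interval ht.1 ht.2 le_rfl
      (Filter.Eventually.of_forall fun _ => abs_nonneg _)
      (Continuous.intervalIntegrable (by fun_prop) _ _)
  rw [h1] at h2
  linarith [neg_abs_le (g.eval v - g.eval t)]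

lemma integral_mul_le_sum_add_variation [IsFiniteMeasure μ] (g : Polynomial ℝ)
    {f : ℝ → ℝ} (hf : Continuous f)
    (hf0 : ∀ x, 0 ≤ f x) {N : ℕ} (q : ℕ → ℝ) {z : ℝ} (h0 : q 0 = -1) (hN : q N = 1)
    (hq : ∀ i < N, q i ≤ q (i + 1)) (hz : ∀ i < N, ∫ t in q i..q (i + 1), f t ∂μ = z) :
    ∫ t in (-1 : ℝ)..1, g.eval t * f t ∂μ ≤
      z * (∑ i ∈ Finset.range N, g.eval (q (i + 1)) +
        ∫ x in (-1 : ℝ)..1, |g.derivative.eval x|) := by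
  have hcell : ∀ i ∈ Finset.range N, ∫ t in q i..q (i + 1), g.eval t * f t ∂μ ≤
      z * (g.eval (q (i + 1)) + ∫ x in q i..q (i + 1), |g.derivative.eval x|) := by
    intro i hi
    rw [Finset.mem_range] at hi
    rw [← hz i hi, mul_comm, ← intervalIntegral.integral_const_mul]
    refine intervalIntegral.integral_mono_on (hq i hi)
      (Continuous.intervalIntegrable (by fun_prop) _ _)
      (Continuous.intervalIntegrable (by fun_prop) _ _) fun t ht => ?_
    exact mul_le_mul_of_nonneg_right (eval_le_add_integral g ht) (hf0 t)
  have h := Finset.sum_le_sum hcell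
  rw [← Finset.mul_sum, Finset.sum_add_distrib,
    intervalIntegral.sum_integral_adjacent_intervals
      (fun k _ => Continuous.intervalIntegrable (by fun_prop) _ _),
    intervalIntegral.sum_integral_adjacent_intervals
      (fun k _ => Continuous.intervalIntegrable (by fun_prop) _ _), h0, hN] at h
  exact h

lemma integral_abs_eval_pos [IsFiniteMeasure μ] [NullSingletonClass μ]
    (hs : ∀ᵐ x ∂μ, x ∈ Icc (-1 : ℝ) 1) (hW : 0 < μ.real univ)
    {g : Polynomial ℝ} (hg : g ≠ 0) : 0 < ∫ x, |g.eval x| ∂μ := by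
  have hi : Integrable (fun x => |g.eval x|) μ := by
    rw [← Measure.restrict_eq_self_of_ae_mem hs]
    exact (show Continuous fun x => |g.eval x| by fun_prop).continuousOn.integrableOn_Icc
  rw [integral_pos_iff_support_of_nonneg (fun x => abs_nonneg _) hi]
  have h1 : (Function.support fun x => |g.eval x|)ᶜ = (g.roots.toFinset : Set ℝ) := by
    ext x; simp [hg]
  have h2 : μ (Function.support fun x => |g.eval x|)ᶜ = 0 := by
    rw [h1]; exact (Finset.finite_toSet _).measure_zero μ
  rw [measure_of_measure_compl_eq_zero h2]
  exact (ENNReal.toReal_pos_iff.1 hW).1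

/-- For a polynomial of mean zero with positive part of integral `A`, the quantiles of the
density `g⁺ + A / W` give a positive sum. -/
lemma sum_eval_quantile_pos [IsFiniteMeasure μ] [NullSingletonClass μ]
    (hs : ∀ᵐ x ∂μ, x ∈ Icc (-1 : ℝ) 1) (hW : 0 < μ.real univ)
    {g : Polynomial ℝ} (hg : g ≠ 0) (hg0 : ∫ x, g.eval x ∂μ = 0) {M D A : ℝ} (hM : 0 < M)
    (hvar : M * ∫ x in (-1 : ℝ)..1, |g.derivative.eval x| ≤ D * ∫ x, |g.eval x| ∂μ)
    {N : ℕ} (hN : 4 * D * μ.real univ / M < N) (hN0 : 0 < N)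
    (hA : A = ∫ x, max (g.eval x) 0 ∂μ) (q : ℕ → ℝ) (h0 : q 0 = -1) (hqN : q N = 1)
    (hq : ∀ i < N, q i ≤ q (i + 1))
    (hz : ∀ i < N, ∫ t in q i..q (i + 1), (max (g.eval t) 0 + A / μ.real univ) ∂μ = 2 * A / N) :
    0 < ∑ i ∈ Finset.range N, g.eval (q (i + 1)) := by
  have hInt : ∀ f : ℝ → ℝ, Continuous f → Integrable f μ := fun f hf => by
    rw [← Measure.restrict_eq_self_of_ae_mem hs]
    exact hf.continuousOn.integrableOn_Icc
  set W := μ.real univ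
  have habs : ∫ x, |g.eval x| ∂μ = 2 * A := by
    have h1 : ∀ x, |g.eval x| = 2 * max (g.eval x) 0 - g.eval x := fun x => by
      rcases max_cases (g.eval x) 0 with ⟨e, h⟩ | ⟨e, h⟩
      · rw [e, abs_of_nonneg h]; ring
      · rw [e, abs_of_neg h]; ring
    simp_rw [h1]
    rw [integral_sub (hInt _ (by fun_prop)) (hInt _ (by fun_prop)), integral_const_mul, hg0, hA,
      sub_zero]
  have hA0 : 0 < A := by
    have := integral_abs_eval_pos hs hW hg
    linarith
  have key := integral_mul_le_sum_add_variation (μ := μ) g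
    (f := fun t => max (g.eval t) 0 + A / W) (by fun_prop)
    (fun x => add_nonneg (le_max_right _ _) (by positivity)) q h0 hqN hq hz
  rw [← integral_eq_intervalIntegral_of_ae_mem hs] at key
  have hsq : A ^ 2 / W ≤ ∫ x, max (g.eval x) 0 ^ 2 ∂μ := by
    have h1 : 0 ≤ ∫ x, (max (g.eval x) 0 - A / W) ^ 2 ∂μ := integral_nonneg fun _ => sq_nonneg _
    have h2 : ∀ x, (max (g.eval x) 0 - A / W) ^ 2 =
        max (g.eval x) 0 ^ 2 - (2 * (A / W) * max (g.eval x) 0 - (A / W) ^ 2) := fun x => by ring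
    simp_rw [h2] at h1
    rw [integral_sub (hInt _ (by fun_prop)) (hInt _ (by fun_prop)),
      integral_sub (hInt _ (by fun_prop)) (hInt _ (by fun_prop)), integral_const_mul, ← hA,
      integral_const, smul_eq_mul] at h1
    have h3 : 2 * (A / W) * A - W * (A / W) ^ 2 = A ^ 2 / W := by field_simp; ring
    linarith
  have hmul : ∫ t, g.eval t * (max (g.eval t) 0 + A / W) ∂μ = ∫ x, max (g.eval x) 0 ^ 2 ∂μ := by
    have h1 : ∀ t, g.eval t * (max (g.eval t) 0 + A / W) =
        max (g.eval t) 0 ^ 2 + A / W * g.eval t := fun t => by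
      rcases max_cases (g.eval t) 0 with ⟨e, h⟩ | ⟨e, h⟩ <;> rw [e] <;> ring
    simp_rw [h1]
    rw [integral_add (hInt _ (by fun_prop)) (hInt _ (by fun_prop)), integral_const_mul, hg0]
    ring
  rw [hmul] at key
  rw [habs] at hvar
  set S := ∑ i ∈ Finset.range N, g.eval (q (i + 1))
  set V := ∫ x in (-1 : ℝ)..1, |g.derivative.eval x|
  have hNr : (0 : ℝ) < N := by exact_mod_cast hN0
  have hV : V ≤ 2 * D * A / M := by rw [le_div_iff₀ hM]; linarith
  have h4 : A ^ 2 / W ≤ 2 * A / N * (S + V) := hsq.trans key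
  have h5 : N * A / (2 * W) ≤ S + V := by
    have h6 : 2 * A / N * (N * A / (2 * W)) = A ^ 2 / W := by field_simp
    rw [← h6] at h4
    exact le_of_mul_le_mul_left h4 (by positivity)
  have h7 : 2 * D * A / M < N * A / (2 * W) := by
    have h8 := mul_lt_mul_of_pos_right hN (show 0 < A / (2 * W) by positivity)
    calc 2 * D * A / M = 4 * D * W / M * (A / (2 * W)) := by field_simp; ring
      _ < N * (A / (2 * W)) := h8
      _ = _ := by ring
  linarith

/-- Existence of equal weight quadrature formulas, from a bound of the variation of polynomials. -/
theorem exists_quadrature [IsFiniteMeasure μ] [NullSingletonClass μ]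
    (hs : ∀ᵐ x ∂μ, x ∈ Icc (-1 : ℝ) 1) (hW : 0 < μ.real univ)
    (hpos : ∀ x ∈ Icc (-1 : ℝ) 1, ∀ y ∈ Icc (-1 : ℝ) 1, x < y → 0 < μ (Ioc x y)) {n : ℕ}
    {M D : ℝ} (hM : 0 < M) (hvar : ∀ g : Polynomial ℝ, g.natDegree ≤ n →
      M * ∫ x in (-1 : ℝ)..1, |g.derivative.eval x| ≤ D * ∫ x, |g.eval x| ∂μ)
    {N : ℕ} (hN : 4 * D * μ.real univ / M < N) (hN0 : 0 < N) :
    ∃ t : Fin N → ℝ, Monotone t ∧ (∀ i, t i ∈ Icc (-1 : ℝ) 1) ∧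
      ∀ p : Polynomial ℝ, p.natDegree ≤ n →
        ∫ x, p.eval x ∂μ = μ.real univ / N * ∑ i, p.eval (t i) := by
  have hInt : ∀ f : ℝ → ℝ, Continuous f → Integrable f μ := fun f hf => by
    rw [← Measure.restrict_eq_self_of_ae_mem hs]
    exact hf.continuousOn.integrableOn_Icc
  have hNr : (0 : ℝ) < N := by exact_mod_cast hN0
  set W := μ.real univ with hWdef
  let h : Fin n → Polynomial ℝ := fun j =>
    Polynomial.X ^ ((j : ℕ) + 1) - Polynomial.C ((∫ x, x ^ ((j : ℕ) + 1) ∂μ) / W)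
  let g : EuclideanSpace ℝ (Fin n) → Polynomial ℝ := fun a => ∑ j, Polynomial.C (a j) * h j
  have hh : ∀ j, ∫ x, (h j).eval x ∂μ = 0 := fun j => by
    simp only [h, Polynomial.eval_sub, Polynomial.eval_pow, Polynomial.eval_X, Polynomial.eval_C]
    rw [integral_sub (hInt _ (by fun_prop)) (hInt _ (by fun_prop)), integral_const, smul_eq_mul,
      mul_div_cancel₀ _ hW.ne', sub_self]
  have hge : ∀ a x, (g a).eval x = ∑ j, a j * (h j).eval x := fun a x => by
    simp [g, Polynomial.eval_finsetSum]
  have hgd : ∀ a, (g a).natDegree ≤ n := fun a => by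
    refine Polynomial.natDegree_sum_le_of_forall_le _ _ fun j _ => ?_
    refine (Polynomial.natDegree_C_mul_le _ _).trans ?_
    rw [Polynomial.natDegree_sub_C, Polynomial.natDegree_X_pow]
    exact j.2
  have hg0 : ∀ a, ∫ x, (g a).eval x ∂μ = 0 := fun a => by
    simp_rw [hge]
    rw [integral_finsetSum _ fun j _ => hInt _ (by fun_prop)]
    simp_rw [integral_const_mul, hh]
    simp
  have hgne : ∀ a, a ≠ 0 → g a ≠ 0 := fun a ha hga => ha <| by
    ext i
    have h1 : (g a).coeff ((i : ℕ) + 1) = a i := by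
      simp only [g, h, Polynomial.finsetSum_coeff, Polynomial.coeff_C_mul, Polynomial.coeff_sub,
        Polynomial.coeff_X_pow, Polynomial.coeff_C_succ]
      rw [Finset.sum_eq_single i (fun j _ hj => by
        rw [if_neg (by simpa [Fin.ext_iff, eq_comm] using hj)]; simp) (by simp)]
      simp
    rw [← h1, hga]; simp
  have hgc : Continuous fun p : EuclideanSpace ℝ (Fin n) × ℝ => (g p.1).eval p.2 := by
    simp_rw [hge]; fun_prop
  let A : EuclideanSpace ℝ (Fin n) → ℝ := fun a => ∫ x, max ((g a).eval x) 0 ∂μ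
  have hAc : Continuous A := by
    simp only [A, integral_eq_intervalIntegral_of_ae_mem hs]
    exact intervalIntegral.continuous_parametric_intervalIntegral_of_continuous'
      (f := fun a x => max ((g a).eval x) 0) (hgc.max continuous_const) _ _
  have hA0 : ∀ a, 0 ≤ A a := fun a => integral_nonneg fun x => le_max_right _ _
  have hApos : ∀ a, a ≠ 0 → 0 < A a := fun a ha => by
    have h1 := integral_abs_eval_pos hs hW (hgne a ha)
    have h2 : ∀ x, |(g a).eval x| = 2 * max ((g a).eval x) 0 - (g a).eval x := fun x => by
      rcases max_cases ((g a).eval x) 0 with ⟨e, h⟩ | ⟨e, h⟩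
      · rw [e, abs_of_nonneg h]; ring
      · rw [e, abs_of_neg h]; ring
    simp_rw [h2] at h1
    rw [integral_sub (hInt _ (by fun_prop)) (hInt _ (by fun_prop)), integral_const_mul, hg0] at h1
    simp only [A]
    linarith
  let f : EuclideanSpace ℝ (Fin n) → ℝ → ℝ := fun a t =>
    max ((g a).eval t) 0 + (A a / W + max 0 (1 - ‖a‖))
  have hf : Continuous (Function.uncurry f) :=
    (hgc.max continuous_const).add (by fun_prop)
  have hf0 : ∀ a t, 0 < f a t := fun a t => by
    refine add_pos_of_nonneg_of_pos (le_max_right _ _) ?_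
    rcases eq_or_ne a 0 with rfl | ha
    · refine add_pos_of_nonneg_of_pos (div_nonneg (hA0 _) hW.le) (by simp)
    · exact add_pos_of_pos_of_nonneg (div_pos (hApos a ha) hW) (le_max_left _ _)
  have hfc : ∀ a, Continuous (f a) := fun a => hf.comp (Continuous.prodMk_right a)
  have hquant : ∀ i : ℕ, ∃ q : EuclideanSpace ℝ (Fin n) → ℝ, i ≤ N → Continuous q ∧
      ∀ a, q a ∈ Icc (-1 : ℝ) 1 ∧
        ∫ t in (-1 : ℝ)..q a, f a t ∂μ = (i / N : ℝ) * ∫ t in (-1 : ℝ)..1, f a t ∂μ := by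
    intro i
    by_cases hi : i ≤ N
    · obtain ⟨q, hq⟩ := exists_continuous_quantile hpos f hf hf0 (s := (i / N : ℝ))
        ⟨by positivity, div_le_one_of_le₀ (by exact_mod_cast hi) hNr.le⟩
      exact ⟨q, fun _ => hq⟩
    · exact ⟨fun _ => 0, fun h => absurd h hi⟩
  choose q hq using hquant
  have hinc : ∀ a, ∀ i j : ℕ, i ≤ j → j ≤ N → q i a ≤ q j a := by
    intro a i j hij hj
    obtain ⟨hi1, hi2⟩ := (hq i (hij.trans hj)).2 a
    obtain ⟨hj1, hj2⟩ := (hq j hj).2 a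
    refine ((strictMonoOn_intervalIntegral hpos (hfc a) (hf0 a)).le_iff_le hi1 hj1).1 ?_
    simp only [hi2, hj2]
    have hZ : 0 ≤ ∫ t in (-1 : ℝ)..1, f a t ∂μ :=
      intervalIntegral.integral_nonneg (by norm_num) fun t _ => (hf0 a t).le
    gcongr
  have hq0 : ∀ a, q 0 a = -1 := fun a => by
    obtain ⟨h1, h2⟩ := (hq 0 hN0.le).2 a
    refine (strictMonoOn_intervalIntegral hpos (hfc a) (hf0 a)).injOn h1 (by simp) ?_
    simp [h2]
  have hqN : ∀ a, q N a = 1 := fun a => by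
    obtain ⟨h1, h2⟩ := (hq N le_rfl).2 a
    refine (strictMonoOn_intervalIntegral hpos (hfc a) (hf0 a)).injOn h1 (by simp) ?_
    simp only [h2]
    rw [div_self hNr.ne', one_mul]
  let F : EuclideanSpace ℝ (Fin n) → EuclideanSpace ℝ (Fin n) := fun a =>
    WithLp.toLp 2 fun j => ∑ i ∈ Finset.range N, (h j).eval (q (i + 1) a)
  have hF : Continuous F := by
    refine (PiLp.continuous_toLp 2 _).comp (continuous_pi fun j => ?_)
    refine continuous_finsetSum _ fun i hi => ?_
    exact (h j).continuous.comp (hq (i + 1) (Finset.mem_range.1 hi)).1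
  obtain ⟨a, ha⟩ := exists_zero_of_inner_pos_on_sphere F hF fun a ha => by
    have ha0 : a ≠ 0 := by rintro rfl; simp at ha
    have hfa : ∀ t, f a t = max ((g a).eval t) 0 + A a / W := fun t => by simp [f, ha]
    have hZ : ∫ t in (-1 : ℝ)..1, f a t ∂μ = 2 * A a := by
      rw [← integral_eq_intervalIntegral_of_ae_mem hs]
      simp_rw [hfa]
      rw [integral_add (hInt _ (by fun_prop)) (hInt _ (by fun_prop)), integral_const, smul_eq_mul,
        mul_div_cancel₀ _ hW.ne']
      simp only [A]; ring
    have hsum := sum_eval_quantile_pos hs hW (hgne a ha0) (hg0 a) hM (hvar _ (hgd a)) hN hN0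
      (A := A a) rfl (fun i => q i a) (hq0 a) (hqN a)
      (fun i hi => hinc a i (i + 1) (by omega) hi) (fun i hi => by
        simp_rw [← hWdef, ← hfa]
        have h1 := ((hq i hi.le).2 a).2
        have h2 := ((hq (i + 1) hi).2 a).2
        have h3 := intervalIntegral.integral_add_adjacent_intervals
          ((hfc a).intervalIntegrable (μ := μ) (-1) (q i a))
          ((hfc a).intervalIntegrable (q i a) (q (i + 1) a))
        rw [h1, h2, hZ] at h3
        push_cast at h3
        rw [eq_sub_of_add_eq' h3]
        ring)
    refine hsum.trans_eq ?_
    simp only [hge, F, PiLp.inner_apply, RCLike.inner_apply, conj_trivial]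
    rw [Finset.sum_comm]
    refine Finset.sum_congr rfl fun j _ => ?_
    rw [Finset.mul_sum]
  have hF0 : ∀ j, ∑ i ∈ Finset.range N, (h j).eval (q (i + 1) a) = 0 := fun j => by
    have := congrArg (fun v : EuclideanSpace ℝ (Fin n) => v j) ha
    simpa [F] using this
  refine ⟨fun i => q (i + 1) a, fun i j hij => hinc a _ _ (by simpa using hij) j.2,
    fun i => ((hq (i + 1) i.2).2 a).1, fun p hp => ?_⟩
  rw [Fin.sum_univ_eq_sum_range (fun i => p.eval (q (i + 1) a))]
  have hmom : ∀ k ≤ n, ∫ x, x ^ k ∂μ = W / N * ∑ i ∈ Finset.range N, q (i + 1) a ^ k := by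
    intro k hk
    rcases k with _ | k
    · simp [hWdef, hNr.ne']
    · have h1 := hF0 ⟨k, hk⟩
      simp only [h, Polynomial.eval_sub, Polynomial.eval_pow, Polynomial.eval_X,
        Polynomial.eval_C, Finset.sum_sub_distrib, Finset.sum_const, Finset.card_range,
        nsmul_eq_mul] at h1
      rw [sub_eq_zero.1 h1]
      field_simp
  simp_rw [Polynomial.eval_eq_sum_range]
  rw [integral_finsetSum _ fun j _ => hInt _ (by fun_prop), Finset.sum_comm, Finset.mul_sum]
  refine Finset.sum_congr rfl fun k hk => ?_
  rw [integral_const_mul, hmom k (by have := Finset.mem_range.1 hk; omega), ← Finset.mul_sum]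
  ring

end Existence

section Weight

variable {w : ℝ → ℝ}

/-- The measure with density `w`. -/
def weightMeasure (w : ℝ → ℝ) : Measure ℝ := volume.withDensity fun x => ENNReal.ofReal (w x)

instance : NullSingletonClass (weightMeasure w) := by
  unfold weightMeasure; infer_instance

lemma IsWeight.integrable (hw : IsWeight w) : Integrable w := by
  obtain ⟨-, -, h2, h3, -⟩ := hw
  rw [intervalIntegrable_iff_integrableOn_Icc_of_le (by norm_num)] at h3
  refine (integrableOn_iff_integrable_of_support_subset fun x hx => ?_).1 h3
  by_contra h
  exact hx (h2 x h)

lemma IsWeight.isFiniteMeasure (hw : IsWeight w) : IsFiniteMeasure (weightMeasure w) :=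
  isFiniteMeasure_withDensity_ofReal hw.integrable.2

lemma IsWeight.ae_mem (hw : IsWeight w) : ∀ᵐ x ∂weightMeasure w, x ∈ Icc (-1 : ℝ) 1 := by
  rw [ae_iff]
  change weightMeasure w (Icc (-1 : ℝ) 1)ᶜ = 0
  rw [weightMeasure, withDensity_apply _ measurableSet_Icc.compl,
    setLIntegral_congr_fun (g := fun _ => 0) measurableSet_Icc.compl fun x hx => by
      simp [hw.2.2.1 x hx]]
  simp

lemma IsWeight.real_Icc (hw : IsWeight w) {a b : ℝ} (hab : a ≤ b) :
    (weightMeasure w).real (Icc a b) = ∫ t in a..b, w t := by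
  rw [intervalIntegral.integral_of_le hab, ← integral_Icc_eq_integral_Ioc, Measure.real,
    weightMeasure, withDensity_apply _ measurableSet_Icc,
    integral_eq_lintegral_of_nonneg_ae (Filter.Eventually.of_forall hw.2.1)
      hw.integrable.aestronglyMeasurable.restrict]

lemma IsWeight.integral (hw : IsWeight w) (f : ℝ → ℝ) :
    ∫ x, f x ∂weightMeasure w = ∫ x in (-1 : ℝ)..1, f x * w x := by
  rw [weightMeasure, integral_withDensity_eq_integral_toReal_smul
    hw.1.ennreal_ofReal (Filter.Eventually.of_forall fun _ => ENNReal.ofReal_lt_top),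
    intervalIntegral.integral_of_le (by norm_num), ← integral_Icc_eq_integral_Ioc,
    setIntegral_eq_integral_of_forall_compl_eq_zero fun x hx => by rw [hw.2.2.1 x hx, mul_zero]]
  refine integral_congr_ae (Filter.Eventually.of_forall fun x => ?_)
  simp [ENNReal.toReal_ofReal (hw.2.1 x), mul_comm]

lemma IsWeight.real_univ (hw : IsWeight w) :
    (weightMeasure w).real univ = ∫ x in (-1 : ℝ)..1, w x := by
  have := hw.integral fun _ => 1
  simpa using this

lemma IsWeight.isDoublingMeasure (hw : IsWeight w) {L : ℝ} (hd : IsDoubling w L) :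
    IsDoublingMeasure (weightMeasure w) L := fun δ hδ a ha => by
  rw [hw.real_Icc (by linarith), hw.real_Icc (by linarith)]
  exact hd δ hδ a ha

end Weight

theorem chebyshev_quadrature_doubling_weight (L : ℝ) (hL : 2 ≤ L) :
    ∃ c > (0:ℝ), ∃ C > (0:ℝ),
      ∀ w : ℝ → ℝ, IsWeight w → IsDoubling w L → ∀ n : ℕ, 1 ≤ n →
        (∀ N : ℕ, ∀ t : Fin N → ℝ, IsChebQuad w n N t → c * Rw w n ≤ N) ∧
        (∀ N : ℕ, C * Rw w n ≤ N → ∃ t : Fin N → ℝ, IsChebQuad w n N t) := by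
  have hL0 : 0 ≤ L := by linarith
  obtain ⟨C, hC, hlow⟩ := exists_total_le_of_quadrature (L := L) (by linarith)
  refine ⟨C⁻¹, by positivity, 5 * L ^ 8, by positivity, fun w hw hdw n hn => ?_⟩
  have hfin := hw.isFiniteMeasure
  have hs := hw.ae_mem
  have hd := hw.isDoublingMeasure hdw
  have hn0 : (0 : ℝ) < n := by exact_mod_cast hn
  have hW : 0 < (weightMeasure w).real univ := hw.real_univ ▸ hw.2.2.2.2
  set μ := weightMeasure w with hμ
  have hball : ∀ x, ∫ t in (x - Δn n x)..(x + Δn n x), w t =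
      μ.real (Icc (x - Δn n x) (x + Δn n x)) := fun x =>
    (hw.real_Icc (by linarith [Δn_pos hn x])).symm
  have hRw : Rw w n = μ.real univ /
      sInf ((fun x => μ.real (Icc (x - Δn n x) (x + Δn n x))) '' Icc (-1 : ℝ) 1) := by
    rw [Rw, hw.real_univ]
    simp_rw [hball]
  set M := sInf ((fun x => μ.real (Icc (x - Δn n x) (x + Δn n x))) '' Icc (-1 : ℝ) 1) with hMdef
  have hMle : ∀ x ∈ Icc (-1 : ℝ) 1, M ≤ μ.real (Icc (x - Δn n x) (x + Δn n x)) := fun x hx =>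
    csInf_le ⟨0, by rintro _ ⟨y, -, rfl⟩; exact measureReal_nonneg⟩ ⟨x, hx, rfl⟩
  have hleM : ∀ b, (∀ x ∈ Icc (-1 : ℝ) 1, b ≤ μ.real (Icc (x - Δn n x) (x + Δn n x))) → b ≤ M :=
    fun b h => le_csInf (Nonempty.image _ ⟨0, by simp⟩) (by rintro _ ⟨y, hy, rfl⟩; exact h y hy)
  have hM : 0 < M := by
    obtain ⟨k, hk⟩ := pow_unbounded_of_one_lt (2 * (n : ℝ) ^ 2) (one_lt_two (α := ℝ))
    have hLk : 0 < L ^ k := pow_pos (by linarith) k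
    refine (div_pos hW hLk).trans_le (hleM _ fun x hx => ?_)
    rw [div_le_iff₀' hLk]
    refine hd.total_le hL0 hs k (Δn_pos hn x) hx ?_
    have h1 : 1 / (n : ℝ) ^ 2 ≤ Δn n x := by
      unfold Δn
      have : 1 / (n : ℝ) ^ 2 = 1 / n * (0 + 1 / n) := by field_simp; ring
      rw [this]
      gcongr
      positivity
    calc (2 : ℝ) = 2 * (n : ℝ) ^ 2 * (1 / (n : ℝ) ^ 2) := by field_simp
      _ ≤ 2 ^ k * Δn n x := by gcongr
  rw [hRw]
  refine ⟨fun N t ht => ?_, fun N hN => ?_⟩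
  · have h := hlow μ hfin hd hs n hn N t ht.2.1 fun p hp => by
      rw [hw.integral, hw.real_univ, ht.2.2 p hp]
    rcases Nat.eq_zero_or_pos N with rfl | hNpos
    · have := h 0 (by simp)
      simp only [CharP.cast_eq_zero, zero_mul] at this
      linarith
    have hNr : (0 : ℝ) < N := by exact_mod_cast hNpos
    have h1 : μ.real univ / (N * C) ≤ M := hleM _ fun x hx => by
      rw [div_le_iff₀ (by positivity)]
      exact (h x hx).trans_eq (by ring)
    rw [div_le_iff₀ (by positivity)] at h1
    rw [inv_mul_le_iff₀ hC, div_le_iff₀ hM]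
    linarith
  · have hR : 0 < μ.real univ / M := div_pos hW hM
    have hL8 : 0 < L ^ 8 := pow_pos (by linarith) 8
    have hNr : (0 : ℝ) < N := lt_of_lt_of_le (by positivity) hN
    have hpos : ∀ x ∈ Icc (-1 : ℝ) 1, ∀ y ∈ Icc (-1 : ℝ) 1, x < y → 0 < μ (Ioc x y) := by
      intro x hx y hy hxy
      have h := hd.pos hL0 hs hW (δ := (y - x) / 2) (a := (x + y) / 2) (by linarith)
        ⟨by linarith [hx.1, hy.1], by linarith [hx.2, hy.2]⟩
      rw [show (x + y) / 2 - (y - x) / 2 = x by ring, show (x + y) / 2 + (y - x) / 2 = y by ring,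
        measureReal_congr Ioc_ae_eq_Icc.symm] at h
      exact (ENNReal.toReal_pos_iff.1 h).1
    obtain ⟨t, ht1, ht2, ht3⟩ := exists_quadrature hs hW hpos hM
      (fun g hg => integral_abs_derivative_le (by linarith) hd hs hn hM hMle g hg) (N := N)
      (lt_of_lt_of_le (by
        rw [mul_div_assoc]
        have : 0 < L ^ 8 * (μ.real univ / M) := by positivity
        linarith) hN) (by exact_mod_cast hNr)
    refine ⟨t, ht1, ht2, fun p hp => ?_⟩
    rw [← hw.real_univ, ← hw.integral, ht3 p hp]
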